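/- The Gauss hypergeometric series satisfies ₂F₁(1/30, 8/15; 9/10; 20736/45125) = (1/6) · √2 · 3^{1/10} · 5^{1/10} · 19^{1/15} · √(5+√5). -/

import Mathlib

open scoped Nat

/-- Pochhammer symbol (rising factorial) on the reals. -/
noncomputable def poch (a : ℝ) (n : ℕ) : ℝ := ∏ i ∈ Finset.range n, (a + i)

/-- Gauss hypergeometric series ₂F₁(a,b;c;x) as a real series. -/
noncomputable def twoFone (a b c x : ℝ) : ℝ :=
  ∑' n : ℕ, poch a n * poch b n / (poch c n * (n ! : ℝ)) * x ^ n

open Filter Topology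


noncomputable def tc (a b c : ℝ) (n : ℕ) : ℝ := poch a n * poch b n / (poch c n * (n ! : ℝ))

lemma poch_succ (a : ℝ) (n : ℕ) : poch a (n+1) = poch a n * (a + n) := by
  simp [poch, Finset.prod_range_succ]

lemma poch_zero (a : ℝ) : poch a 0 = 1 := by simp [poch]

lemma poch_succ' (a : ℝ) (n : ℕ) : poch a (n+1) = a * poch (a+1) n := by
  simp only [poch, Finset.prod_range_succ']
  rw [mul_comm]
  congr 1
  · simp
  · apply Finset.prod_congr rfl
    intro i _
    push_cast
    ring

lemma poch_pos {a : ℝ} (ha : 0 < a) (n : ℕ) : 0 < poch a n := by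
  unfold poch
  apply Finset.prod_pos
  intro i _
  positivity

lemma tc_zero (a b c : ℝ) : tc a b c 0 = 1 := by simp [tc, poch_zero]

lemma tc_pos {a b c : ℝ} (ha : 0 < a) (hb : 0 < b) (hc : 0 < c) (n : ℕ) : 0 < tc a b c n := by
  unfold tc
  have := poch_pos ha n
  have := poch_pos hb n
  have := poch_pos hc n
  positivity

lemma tc_rec {a b c : ℝ} (hc : 0 < c) (n : ℕ) :
    ((n:ℝ)+1) * (c+n) * tc a b c (n+1) = (a+n)*(b+n)*tc a b c n := by
  unfold tc
  have h1 := poch_pos hc n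
  have h2 : (0:ℝ) < c + n := by positivity
  have h3 : (0:ℝ) < (n ! : ℝ) := by positivity
  simp only [poch_succ, Nat.factorial_succ]
  push_cast
  field_simp

lemma tc_succ {a b c : ℝ} (hc : 0 < c) (n : ℕ) :
    ((n:ℝ)+1) * tc a b c (n+1) = a*b/c * tc (a+1) (b+1) (c+1) n := by
  unfold tc
  have h1 : 0 < poch (c+1) n := poch_pos (by linarith) n
  have h3 : (0:ℝ) < (n ! : ℝ) := by positivity
  simp only [poch_succ', Nat.factorial_succ]
  push_cast
  field_simp

lemma twoFone_def (a b c x : ℝ) : twoFone a b c x = ∑' n : ℕ, tc a b c n * x ^ n := rfl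

lemma hasSum_of_eq {f g : ℕ → ℝ} {s : ℝ} (h : HasSum f s) (e : ∀ n, g n = f n) : HasSum g s := by
  have : g = f := funext e
  rw [this]; exact h

lemma tc_summable {a b c : ℝ} (ha : 0 < a) (hb : 0 < b) (hc : 0 < c) {x : ℝ} (hx : |x| < 1) :
    Summable (fun n => tc a b c n * x ^ n) := by
  rcases eq_or_ne x 0 with rfl | h0
  · apply summable_of_ne_finset_zero (s := {0})
    intro n hn
    simp at hn
    simp [hn]
  apply summable_of_ratio_test_tendsto_lt_one hx
  · filter_upwards with n
    exact mul_ne_zero (tc_pos ha hb hc n).ne' (pow_ne_zero _ h0)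
  · have key : ∀ n : ℕ, ‖tc a b c (n+1) * x^(n+1)‖ / ‖tc a b c n * x^n‖ =
        ((a+n)/(c+n)) * ((b+n)/(1+n)) * |x| := by
      intro n
      have h1 := tc_pos ha hb hc n
      have h2 := tc_pos ha hb hc (n+1)
      have h3 := tc_rec (a:=a) (b:=b) hc n
      have h4 : (0:ℝ) < c + n := by positivity
      have h5 : (0:ℝ) < 1 + n := by positivity
      have h6 : 0 < |x| := abs_pos.mpr h0
      rw [norm_mul, norm_mul, norm_pow, norm_pow, Real.norm_of_nonneg h1.le, Real.norm_of_nonneg h2.le, Real.norm_eq_abs]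
      rw [pow_succ]
      field_simp
      linear_combination h3
    simp_rw [key]
    have lim : ∀ u v : ℝ, Tendsto (fun n : ℕ => (u+n)/(v+n)) atTop (𝓝 1) := by
      intro u v
      have := (tendsto_natCast_div_add_atTop (𝕜 := ℝ) v)
      have h2 : Tendsto (fun n : ℕ => u / (v + n)) atTop (𝓝 0) := by
        apply Tendsto.div_atTop tendsto_const_nhds
        exact tendsto_atTop_add_const_left _ _ tendsto_natCast_atTop_atTop
      have := h2.add this
      simp only [zero_add] at this
      refine this.congr ?_
      intro n
      rw [add_comm (n:ℝ) v, ← add_div]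
    have := ((lim a c).mul (lim b 1)).mul_const |x|
    simpa using this

lemma F_hasDerivAt {a b c : ℝ} (ha : 0 < a) (hb : 0 < b) (hc : 0 < c) {x : ℝ} (hx : |x| < 1) :
    HasDerivAt (twoFone a b c) (a*b/c * twoFone (a+1) (b+1) (c+1) x) x := by
  obtain ⟨r, hr1, hr2⟩ := exists_between hx
  have hr0 : 0 < r := lt_of_le_of_lt (abs_nonneg _) hr1
  have hs' : Summable (fun n => tc (a+1) (b+1) (c+1) n * r^n) :=
    tc_summable (by linarith) (by linarith) (by linarith) (by rwa [abs_of_pos hr0])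
  have hs'' := hs'.mul_left (a*b/c)
  have hu : Summable (fun n : ℕ => tc a b c n * (n * r^(n-1))) := by
    rw [← summable_nat_add_iff 1]
    refine hs''.congr ?_
    intro n
    have := tc_succ (a:=a) (b:=b) hc n
    show _ = tc a b c (n+1) * (((n+1:ℕ):ℝ) * r^n)
    push_cast
    linear_combination (-r^n)*this
  have h := hasDerivAt_tsum_of_isPreconnected (𝕜 := ℝ) (g := fun n z => tc a b c n * z^n)
    (g' := fun n z => tc a b c n * (n * z^(n-1))) (t := Metric.ball 0 r) (y₀ := x) (y := x) hu
    Metric.isOpen_ball (convex_ball _ _).isPreconnected ?_ ?_ ?_ ?_ ?_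
  · refine h.congr_deriv ?_
    have hs3 := (tc_summable (a := a+1) (b := b+1) (c := c+1) (by linarith) (by linarith) (by linarith) hx)
    have hsx : Summable (fun n : ℕ => tc a b c n * (n * x^(n-1))) := by
      rw [← summable_nat_add_iff 1]
      refine (hs3.mul_left (a*b/c)).congr ?_
      intro n
      have := tc_succ (a:=a) (b:=b) hc n
      show _ = tc a b c (n+1) * (((n+1:ℕ):ℝ) * x^n)
      push_cast
      linear_combination (-x^n)*this
    rw [hsx.tsum_eq_zero_add, twoFone_def, ← tsum_mul_left]
    simp only [Nat.cast_zero, zero_mul, mul_zero, zero_add, Nat.add_sub_cancel]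
    apply tsum_congr
    intro n
    have := tc_succ (a:=a) (b:=b) hc n
    push_cast
    linear_combination (x^n)*this
  · intro n y _
    exact (hasDerivAt_pow n y).const_mul _
  · intro n y hy
    have hy' : |y| < r := by simpa using hy
    have h1 := tc_pos ha hb hc n
    rw [norm_mul, norm_mul, norm_pow, Real.norm_of_nonneg h1.le, Real.norm_natCast, Real.norm_eq_abs]
    gcongr
  · simpa using hr1
  · exact tc_summable ha hb hc hx
  · simpa using hr1

lemma F_hasSum {a b c : ℝ} (ha : 0 < a) (hb : 0 < b) (hc : 0 < c) {x : ℝ} (hx : |x| < 1) :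
    HasSum (fun n => tc a b c n * x ^ n) (twoFone a b c x) := (tc_summable ha hb hc hx).hasSum

noncomputable def F1 (a b c x : ℝ) : ℝ := a*b/c * twoFone (a+1) (b+1) (c+1) x
noncomputable def F2 (a b c x : ℝ) : ℝ := a*b/c * F1 (a+1) (b+1) (c+1) x

lemma F1_hasDerivAt {a b c : ℝ} (ha : 0 < a) (hb : 0 < b) (hc : 0 < c) {x : ℝ} (hx : |x| < 1) :
    HasDerivAt (F1 a b c) (F2 a b c x) x :=
  (F_hasDerivAt (a := a+1) (b := b+1) (c := c+1) (by linarith) (by linarith) (by linarith) hx).const_mul _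

lemma F1_hasSum {a b c : ℝ} (ha : 0 < a) (hb : 0 < b) (hc : 0 < c) {x : ℝ} (hx : |x| < 1) :
    HasSum (fun n : ℕ => ((n:ℝ)+1) * tc a b c (n+1) * x ^ n) (F1 a b c x) := by
  have := (F_hasSum (a := a+1) (b := b+1) (c := c+1) (by linarith) (by linarith) (by linarith) hx).mul_left (a*b/c)
  refine hasSum_of_eq (this) (fun n => ?_)
  rw [tc_succ hc]; ring

lemma F2_hasSum {a b c : ℝ} (ha : 0 < a) (hb : 0 < b) (hc : 0 < c) {x : ℝ} (hx : |x| < 1) :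
    HasSum (fun n : ℕ => ((n:ℝ)+2) * ((n:ℝ)+1) * tc a b c (n+2) * x ^ n) (F2 a b c x) := by
  have := (F1_hasSum (a := a+1) (b := b+1) (c := c+1) (by linarith) (by linarith) (by linarith) hx).mul_left (a*b/c)
  refine hasSum_of_eq (this) (fun n => ?_)
  have := tc_succ (a := a) (b := b) hc (n+1)
  push_cast at this
  linear_combination ((n:ℝ)+1)*x^n*this

lemma hasSum_shift {f : ℕ → ℝ} {s : ℝ} (h : HasSum (fun n => f (n+1)) s) (h0 : f 0 = 0) : HasSum f s := by
  have := (hasSum_nat_add_iff 1).1 h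
  simpa [h0] using this

lemma F_ode {a b c : ℝ} (ha : 0 < a) (hb : 0 < b) (hc : 0 < c) {x : ℝ} (hx : |x| < 1) :
    x * (1-x) * F2 a b c x + (c - (a+b+1)*x) * F1 a b c x - a*b*twoFone a b c x = 0 := by
  have e0 := F_hasSum ha hb hc hx
  have e1 := F1_hasSum ha hb hc hx
  have e2 := F2_hasSum ha hb hc hx
  have e3 : HasSum (fun n : ℕ => (n:ℝ) * tc a b c n * x^n) (x * F1 a b c x) := by
    apply hasSum_shift
    · refine hasSum_of_eq (e1.mul_left x) (fun n => ?_)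
      push_cast; ring
    · simp
  have e4 : HasSum (fun n : ℕ => (n+1:ℝ) * n * tc a b c (n+1) * x^n) (x * F2 a b c x) := by
    apply hasSum_shift
    · refine hasSum_of_eq (e2.mul_left x) (fun n => ?_)
      push_cast; ring
    · simp
  have e5 : HasSum (fun n : ℕ => (n:ℝ) * (n-1) * tc a b c n * x^n) (x * (x * F2 a b c x)) := by
    apply hasSum_shift
    · refine hasSum_of_eq (e4.mul_left x) (fun n => ?_)
      push_cast; ring
    · simp
  have e6 := (((e4.sub e5).add (e1.mul_left c)).sub (e3.mul_left (a+b+1))).sub (e0.mul_left (a*b))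
  have e7 : HasSum (fun n : ℕ => (0:ℝ)) 0 := hasSum_zero
  have := e6.unique (by
    refine hasSum_of_eq (e7) (fun n => ?_)
    have := tc_rec (a:=a) (b:=b) hc n
    linear_combination x^n*this)
  linear_combination this

lemma F_zero (a b c : ℝ) : twoFone a b c 0 = 1 := by
  rw [twoFone_def, tsum_eq_single 0]
  · simp [tc_zero]
  · intro n hn; simp [hn]

lemma F_ge_one {a b c : ℝ} (ha : 0 < a) (hb : 0 < b) (hc : 0 < c) {x : ℝ} (h0 : 0 ≤ x) (hx : x < 1) :
    1 ≤ twoFone a b c x := by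
  have h := F_hasSum ha hb hc (x := x) (by rwa [abs_of_nonneg h0])
  have := h.summable.le_tsum 0 (fun n _ => by have := tc_pos ha hb hc n; positivity)
  rw [h.tsum_eq] at this
  simpa [tc_zero] using this

lemma F_analyticAt {a b c : ℝ} (ha : 0 < a) (hb : 0 < b) (hc : 0 < c) {x : ℝ} (hx : |x| < 1) :
    AnalyticAt ℝ (twoFone a b c) x := by
  obtain ⟨r, hr1, hr2⟩ := exists_between hx
  have hr0 : 0 < r := lt_of_le_of_lt (abs_nonneg _) hr1
  lift r to NNReal using hr0.le
  let p := FormalMultilinearSeries.ofScalars ℝ (tc a b c)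
  have hrad : (r:ENNReal) ≤ p.radius := by
    apply p.le_radius_of_summable_norm
    refine (tc_summable ha hb hc (x := r) (by rwa [abs_of_pos hr0])).congr ?_
    intro n
    rw [FormalMultilinearSeries.ofScalars_norm, Real.norm_of_nonneg (tc_pos ha hb hc n).le]
  have h := p.hasFPowerSeriesOnBall (lt_of_lt_of_le (by exact_mod_cast hr0) hrad)
  have h2 : AnalyticAt ℝ p.sum x := by
    apply h.analyticAt_of_mem
    apply Metric.eball_subset_eball hrad
    rw [Metric.eball_coe]
    simpa using hr1
  have h3 : p.sum = twoFone a b c := by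
    funext z
    rw [twoFone_def]
    simp [FormalMultilinearSeries.sum, p, mul_comm]
  rwa [h3] at h2


lemma tc_c_succ {a b c : ℝ} (hc : 0 < c) (n : ℕ) :
    (c+n) * tc a b (c+1) n = c * tc a b c n := by
  unfold tc
  have h1 : 0 < poch (c+1) n := poch_pos (by linarith) n
  have h0 : 0 < poch c n := poch_pos (by linarith) n
  have h3 : (0:ℝ) < (n ! : ℝ) := by positivity
  have := poch_succ c n
  rw [poch_succ'] at this
  field_simp
  linear_combination (-(poch a n * poch b n))*this

lemma w_tele {a b c : ℝ} (hc : 0 < c) (n : ℕ) :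
    (n:ℝ) * tc a b c n - ((n+1:ℕ):ℝ) * tc a b c (n+1) =
      tc a b c n * ((c-a-b)*n - a*b)/(c+n) := by
  have h := tc_rec (a:=a) (b:=b) hc n
  have h4 : (0:ℝ) < c + n := by positivity
  push_cast
  field_simp
  linear_combination (-1)*h

lemma tc_summable_one {a b c : ℝ} (ha : 0 < a) (hb : 0 < b) (hc : 0 < c) (hs : 0 < c-a-b) :
    Summable (tc a b c) := by
  obtain ⟨K, hK⟩ := exists_nat_gt ((2*(a*b) + c*(c-a-b))/(c-a-b))
  rw [div_lt_iff₀ hs] at hK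
  rw [← summable_nat_add_iff K]
  have hpos := tc_pos ha hb hc
  apply summable_of_sum_range_le (c := 2/(c-a-b) * (K * tc a b c K))
  · intro n; exact (hpos _).le
  · have key : ∀ n : ℕ, ∑ i ∈ Finset.range n, tc a b c (i+K) ≤
        2/(c-a-b) * (K * tc a b c K - ((n+K:ℕ):ℝ) * tc a b c (n+K)) := by
      intro n
      induction n with
      | zero => simp
      | succ n ih =>
        rw [Finset.sum_range_succ]
        have h := w_tele (a:=a) (b:=b) hc (n+K)
        have h5 : tc a b c (n+K) ≤ 2/(c-a-b) * (tc a b c (n+K) * ((c-a-b)*((n+K:ℕ):ℝ) - a*b)/(c+((n+K:ℕ):ℝ))) := by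
          have h4 : (0:ℝ) < c + ((n+K:ℕ):ℝ) := by positivity
          have h6 := hpos (n+K)
          rw [mul_div_assoc', div_mul_eq_mul_div, div_div, le_div_iff₀ (by positivity)]
          push_cast
          have : (0:ℝ) ≤ n := by positivity
          nlinarith [mul_nonneg this hs.le]
        rw [← h] at h5
        have e : n + 1 + K = n + K + 1 := by ring
        rw [e]
        linarith
    intro n
    refine (key n).trans ?_
    have := hpos (n+K)
    gcongr
    have : 0 ≤ ((n+K:ℕ):ℝ) * tc a b c (n+K) := by positivity
    linarith

lemma w_tendsto {a b c : ℝ} (ha : 0 < a) (hb : 0 < b) (hc : 0 < c) (hs : 0 < c-a-b) :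
    Tendsto (fun n : ℕ => (n:ℝ) * tc a b c n) atTop (𝓝 0) ∧
    HasSum (fun n : ℕ => (n:ℝ) * tc a b c n - ((n+1:ℕ):ℝ) * tc a b c (n+1)) 0 := by
  have hsum := tc_summable_one ha hb hc hs
  have hpos := tc_pos ha hb hc
  have hsum' := tc_summable_one (c := c+1) ha hb (by linarith) (by linarith)
  have hd : Summable (fun n : ℕ => (n:ℝ) * tc a b c n - ((n+1:ℕ):ℝ) * tc a b c (n+1)) := by
    refine ((hsum.mul_left (c-a-b)).sub (hsum'.mul_left ((c-a)*(c-b)/c))).congr ?_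
    intro n
    rw [w_tele hc]
    have h4 : (0:ℝ) < c + n := by positivity
    have := tc_c_succ (a:=a) (b:=b) hc n
    field_simp
    linear_combination (-(c-a)*(c-b))*this
  have ht := hd.hasSum.tendsto_sum_nat
  have e : ∀ n : ℕ, ∑ i ∈ Finset.range n, ((i:ℝ) * tc a b c i - ((i+1:ℕ):ℝ) * tc a b c (i+1)) =
     - ((n:ℝ) * tc a b c n) := by
    intro n
    rw [Finset.sum_range_sub' (fun i => ((i:ℕ):ℝ) * tc a b c i)]
    simp
  simp_rw [e] at ht
  set L := ∑' n : ℕ, ((n:ℝ) * tc a b c n - ((n+1:ℕ):ℝ) * tc a b c (n+1)) with hL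
  have hL0 : L = 0 := by
    by_contra hne
    have ht' := ht.neg
    simp only [neg_neg] at ht'
    have hLn : 0 ≤ -L := ge_of_tendsto' ht' (fun n => by have := hpos n; positivity)
    have hLp : 0 < -L := lt_of_le_of_ne hLn (by intro h; apply hne; linarith)
    have hev := ht'.eventually (lt_mem_nhds (show -L/2 < -L by linarith))
    apply Real.not_summable_one_div_natCast
    refine Summable.of_norm_bounded_eventually_nat (hsum.mul_left (2/(-L))) ?_
    filter_upwards [hev, eventually_gt_atTop 0] with n hn h0
    have h0' : (0:ℝ) < n := by exact_mod_cast h0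
    rw [Real.norm_of_nonneg (by positivity), div_mul_eq_mul_div, div_le_div_iff₀ h0' hLp]
    nlinarith
  have hh := hd.hasSum
  rw [← hL, hL0] at hh
  rw [hL0] at ht
  refine ⟨by simpa using ht.neg, hh⟩

lemma S_contig {a b c : ℝ} (ha : 0 < a) (hb : 0 < b) (hc : 0 < c) (hs : 0 < c-a-b) :
    ∑' n, tc a b c n = (c-a)*(c-b)/(c*(c-a-b)) * ∑' n, tc a b (c+1) n := by
  have hsum := tc_summable_one ha hb hc hs
  have hsum' := tc_summable_one (c := c+1) ha hb (by linarith) (by linarith)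
  have h := (w_tendsto ha hb hc hs).2
  have h2 := (hsum.hasSum.mul_left (c-a-b)).sub (hsum'.hasSum.mul_left ((c-a)*(c-b)/c))
  have := h2.unique (hasSum_of_eq h (fun n => by
    rw [w_tele hc]
    have h4 : (0:ℝ) < c + n := by positivity
    have := tc_c_succ (a:=a) (b:=b) hc n
    field_simp
    linear_combination (-(c-a)*(c-b))*this))
  have hs' := hs.ne'
  field_simp at this ⊢
  linear_combination this

lemma S_iter {a b c : ℝ} (ha : 0 < a) (hb : 0 < b) (hc : 0 < c) (hs : 0 < c-a-b) (m : ℕ) :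
    ∑' n, tc a b c n = (∏ k ∈ Finset.range m, (c+k-a)*(c+k-b)/((c+k)*(c+k-a-b))) * ∑' n, tc a b (c+m) n := by
  induction m with
  | zero => simp
  | succ m ih =>
    rw [Finset.prod_range_succ, ih, mul_assoc]
    congr 1
    have hm : (0:ℝ) ≤ m := by positivity
    rw [S_contig (c := c+m) ha hb (by linarith) (by linarith)]
    push_cast
    rw [add_assoc]

lemma S_tendsto {a b c : ℝ} (ha : 0 < a) (hb : 0 < b) (hc : 0 < c) (hs : 0 < c-a-b) :
    Tendsto (fun m : ℕ => ∑' n, tc a b (c+m) n) atTop (𝓝 1) := by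
  have hsum := tc_summable_one ha hb hc hs
  have hle : ∀ m : ℕ, ∀ n : ℕ, tc a b (c+m) (n+1) ≤ (c/(c+m)) * tc a b c (n+1) := by
    intro m n
    have hm : (0:ℝ) ≤ m := by positivity
    have hp : poch (c+1) n ≤ poch (c+m+1) n := by
      unfold poch
      apply Finset.prod_le_prod
      · intro i _; positivity
      · intro i _; linarith
    have h1 : 0 < poch (c+1) n := poch_pos (by linarith) n
    have ha1 := poch_pos ha (n+1)
    have hb1 := poch_pos hb (n+1)
    have e : (c/(c+m)) * tc a b c (n+1) = poch a (n+1) * poch b (n+1) / ((c+m) * poch (c+1) n * ((n+1)! : ℝ)) := by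
      unfold tc
      rw [poch_succ' c]
      field_simp
    rw [e]
    unfold tc
    rw [poch_succ' (c+m)]
    gcongr
  have hs1 : Summable (fun n => tc a b c (n+1)) := (summable_nat_add_iff 1).2 hsum
  have hb2 : ∀ m : ℕ, ∑' n, tc a b (c+m) n ≤ 1 + (c/(c+m)) * ∑' n, tc a b c (n+1) := by
    intro m
    have hm : (0:ℝ) ≤ m := by positivity
    have hsm := tc_summable_one (c := c+m) ha hb (by linarith) (by linarith)
    rw [hsm.tsum_eq_zero_add, tc_zero, ← tsum_mul_left]
    gcongr
    · exact (summable_nat_add_iff 1).2 hsm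
    · exact hs1.mul_left _
    · exact hle m _
  have hb1 : ∀ m : ℕ, 1 ≤ ∑' n, tc a b (c+m) n := by
    intro m
    have hm : (0:ℝ) ≤ m := by positivity
    have hsm := tc_summable_one (c := c+m) ha hb (by linarith) (by linarith)
    have := hsm.le_tsum 0 (fun n _ => (tc_pos ha hb (by linarith) n).le)
    rwa [tc_zero] at this
  refine tendsto_of_tendsto_of_tendsto_of_le_of_le tendsto_const_nhds ?_ hb1 hb2
  have h2 : Tendsto (fun n : ℕ => c / (c + n)) atTop (𝓝 0) := by
    apply Tendsto.div_atTop tendsto_const_nhds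
    exact tendsto_atTop_add_const_left _ _ tendsto_natCast_atTop_atTop
  have := (h2.mul_const (∑' n, tc a b c (n+1))).const_add 1
  simpa using this

lemma gauss_val : ∑' n, tc (1/15) (4/15) (2/3) n = Real.sin (2*Real.pi/5) / Real.sin (Real.pi/3) := by
  have h1 := S_tendsto (a := 1/15) (b := 4/15) (c := 2/3) (by norm_num) (by norm_num) (by norm_num) (by norm_num)
  have g1 := Real.GammaSeq_tendsto_Gamma (1/3)
  have g2 := Real.GammaSeq_tendsto_Gamma (2/3)
  have g3 := Real.GammaSeq_tendsto_Gamma (2/5)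
  have g4 := Real.GammaSeq_tendsto_Gamma (3/5)
  have e1 := Real.Gamma_mul_Gamma_one_sub (1/3)
  have e2 := Real.Gamma_mul_Gamma_one_sub (2/5)
  norm_num at e1 e2
  have p3 : 0 < Real.Gamma (2/5) := Real.Gamma_pos_of_pos (by norm_num)
  have p4 : 0 < Real.Gamma (3/5) := Real.Gamma_pos_of_pos (by norm_num)
  have hG := (g1.mul g2).div (g3.mul g4) (by positivity)
  have hG2 := hG.mul ((tendsto_add_atTop_iff_nat 1).2 h1)
  have hc : ∀ᶠ n : ℕ in atTop, (Real.GammaSeq (1/3) n * Real.GammaSeq (2/3) n / (Real.GammaSeq (2/5) n * Real.GammaSeq (3/5) n)) * ∑' k, tc (1/15) (4/15) (2/3+(n+1:ℕ)) k = ∑' n, tc (1/15) (4/15) (2/3) n := by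
    filter_upwards [eventually_gt_atTop 0] with n hn
    rw [S_iter (a := 1/15) (b := 4/15) (c := 2/3) (by norm_num) (by norm_num) (by norm_num) (by norm_num) (n+1)]
    congr 1
    have hn' : (0:ℝ) < n := by exact_mod_cast hn
    unfold Real.GammaSeq
    have q : ∀ s : ℝ, 0 < s → 0 < ∏ j ∈ Finset.range (n+1), (s + j) := fun s hs =>
      Finset.prod_pos (fun i _ => by positivity)
    have q1 := q (1/3) (by norm_num)
    have q2 := q (2/3) (by norm_num)
    have q3 := q (2/5) (by norm_num)
    have q4 := q (3/5) (by norm_num)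
    have r1 : (n:ℝ)^(1/3:ℝ) * (n:ℝ)^(2/3:ℝ) = n := by
      rw [← Real.rpow_add hn']; norm_num
    have r2 : (n:ℝ)^(2/5:ℝ) * (n:ℝ)^(3/5:ℝ) = n := by
      rw [← Real.rpow_add hn']; norm_num
    have e : ∏ k ∈ Finset.range (n+1), (2/3+(k:ℝ)-1/15)*(2/3+k-4/15)/((2/3+k)*(2/3+k-1/15-4/15)) =
       (∏ j ∈ Finset.range (n+1), ((2/5:ℝ) + j)) * (∏ j ∈ Finset.range (n+1), ((3/5:ℝ) + j)) /
       ((∏ j ∈ Finset.range (n+1), ((1/3:ℝ) + j)) * (∏ j ∈ Finset.range (n+1), ((2/3:ℝ) + j))) := by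
      rw [← Finset.prod_mul_distrib, ← Finset.prod_mul_distrib, ← Finset.prod_div_distrib]
      apply Finset.prod_congr rfl
      intro i _
      congr 1 <;> ring
    rw [e]
    have s1 : (0:ℝ) < (n:ℝ)^(1/3:ℝ) := by positivity
    have s2 : (0:ℝ) < (n:ℝ)^(2/3:ℝ) := by positivity
    have s3 : (0:ℝ) < (n:ℝ)^(2/5:ℝ) := by positivity
    have s4 : (0:ℝ) < (n:ℝ)^(3/5:ℝ) := by positivity
    generalize (∏ j ∈ Finset.range (n+1), ((2/5:ℝ) + j)) = A1 at *
    generalize (∏ j ∈ Finset.range (n+1), ((3/5:ℝ) + j)) = A2 at *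
    generalize (∏ j ∈ Finset.range (n+1), ((1/3:ℝ) + j)) = A3 at *
    generalize (∏ j ∈ Finset.range (n+1), ((2/3:ℝ) + j)) = A4 at *
    generalize (n:ℝ)^(1/3:ℝ) = B1 at *
    generalize (n:ℝ)^(2/3:ℝ) = B2 at *
    generalize (n:ℝ)^(2/5:ℝ) = B3 at *
    generalize (n:ℝ)^(3/5:ℝ) = B4 at *
    have hf : (0:ℝ) < (n ! : ℝ) := by positivity
    rw [div_mul_div_comm, div_mul_div_comm, div_div_div_eq]
    rw [div_eq_div_iff (by positivity) (by positivity)]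
    linear_combination (A1*A2*A3*A4*(n !:ℝ)^2)*(r1-r2)
  have := tendsto_nhds_unique (hG2.congr' hc) tendsto_const_nhds
  rw [← this, e1, e2, mul_one]
  have : (0:ℝ) < Real.sin (Real.pi/3) := Real.sin_pos_of_pos_of_lt_pi (by positivity) (by linarith [Real.pi_pos])
  have : (0:ℝ) < Real.sin (2*Real.pi/5) := Real.sin_pos_of_pos_of_lt_pi (by positivity) (by linarith [Real.pi_pos])
  have h5 : Real.pi * (1/3) = Real.pi/3 := by ring
  have h6 : Real.pi * (2/5) = 2*Real.pi/5 := by ring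
  have := Real.pi_pos
  simp only [h5, h6]
  field_simp

lemma gauss_tendsto : Tendsto (fun x => twoFone (1/15) (4/15) (2/3) x) (𝓝[<] 1) (𝓝 (∑' n, tc (1/15) (4/15) (2/3) n)) := by
  have h := (tc_summable_one (a := 1/15) (b := 4/15) (c := 2/3) (by norm_num) (by norm_num) (by norm_num) (by norm_num)).hasSum.tendsto_sum_nat
  exact Real.tendsto_tsum_powerSeries_nhdsWithin_lt h


/-- `u` solves `u'' = P u' + Q u` on `J`, with derivative `u'`. -/
def Sol (J : Set ℝ) (P Q u u' : ℝ → ℝ) : Prop :=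
  ∀ x ∈ J, HasDerivAt u (u' x) x ∧ HasDerivAt u' (P x * u' x + Q x * u x) x

lemma Sol.mono {J K : Set ℝ} {P Q u u' : ℝ → ℝ} (h : Sol J P Q u u') (hK : K ⊆ J) : Sol K P Q u u' :=
  fun x hx => h x (hK hx)

lemma const_of_deriv {J : Set ℝ} (hJ : IsOpen J) (hc : IsPreconnected J) {f : ℝ → ℝ}
    (h : ∀ x ∈ J, HasDerivAt f 0 x) : ∃ k, ∀ x ∈ J, f x = k := by
  rcases J.eq_empty_or_nonempty with rfl | ⟨x0, hx0⟩
  · exact ⟨0, by simp⟩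
  refine ⟨f x0, fun x hx => ?_⟩
  exact hJ.is_const_of_deriv_eq_zero hc (fun y hy => (h y hy).differentiableAt.differentiableWithinAt)
    (fun y hy => (h y hy).deriv) hx hx0

lemma wr_const {J : Set ℝ} (hJ : IsOpen J) (hc : IsPreconnected J) {P Q u u' v v' L : ℝ → ℝ}
    (hL : ∀ x ∈ J, HasDerivAt L (-P x) x) (hu : Sol J P Q u u') (hv : Sol J P Q v v') :
    ∃ k, ∀ x ∈ J, Real.exp (L x) * (u x * v' x - u' x * v x) = k := by
  apply const_of_deriv hJ hc
  intro x hx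
  have h := (hL x hx).exp.mul (((hu x hx).1.mul (hv x hx).2).sub ((hu x hx).2.mul (hv x hx).1))
  refine h.congr_deriv ?_
  simp only [Pi.mul_apply, Pi.sub_apply]
  ring

lemma wr_basis {J : Set ℝ} (hJ : IsOpen J) (hc : IsPreconnected J) {P Q u u' v v' w w' L : ℝ → ℝ}
    (hL : ∀ x ∈ J, HasDerivAt L (-P x) x) (hu : Sol J P Q u u') (hv : Sol J P Q v v')
    (hw : Sol J P Q w w') (hW : ∃ x ∈ J, u x * v' x - u' x * v x ≠ 0) :
    ∃ c1 c2, ∀ x ∈ J, w x = c1 * u x + c2 * v x := by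
  obtain ⟨k, hk⟩ := wr_const hJ hc hL hu hv
  obtain ⟨k1, hk1⟩ := wr_const hJ hc hL hw hv
  obtain ⟨k2, hk2⟩ := wr_const hJ hc hL hu hw
  obtain ⟨x0, hx0, h0⟩ := hW
  have hk0 : k ≠ 0 := by
    rw [← hk x0 hx0]
    exact mul_ne_zero (Real.exp_pos _).ne' h0
  refine ⟨k1/k, k2/k, fun x hx => ?_⟩
  have a := hk x hx
  have a1 := hk1 x hx
  have a2 := hk2 x hx
  field_simp
  linear_combination (-w x) * a + u x * a1 + v x * a2

lemma wr_nonprop {J : Set ℝ} (hJ : IsOpen J) (hc : IsPreconnected J) {P Q u u' v v' : ℝ → ℝ}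
    (hu : Sol J P Q u u') (hv : Sol J P Q v v') (h0 : ∀ x ∈ J, u x ≠ 0)
    (hn : ¬ ∃ k, ∀ x ∈ J, v x = k * u x) : ∃ x ∈ J, u x * v' x - u' x * v x ≠ 0 := by
  by_contra hcon
  push Not at hcon
  apply hn
  obtain ⟨k, hk⟩ := const_of_deriv hJ hc (f := fun x => v x / u x) (fun x hx => by
    refine ((hv x hx).1.div (hu x hx).1 (h0 x hx)).congr_deriv ?_
    rw [div_eq_zero_iff]
    left
    linear_combination hcon x hx)
  refine ⟨k, fun x hx => ?_⟩
  rw [← hk x hx]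
  have := h0 x hx
  field_simp

lemma wr_span {J : Set ℝ} (hJ : IsOpen J) (hc : IsPreconnected J) {P Q u u' v v' w w' L : ℝ → ℝ}
    (hL : ∀ x ∈ J, HasDerivAt L (-P x) x) (hu : Sol J P Q u u') (hv : Sol J P Q v v')
    (hw : Sol J P Q w w') (h0 : ∀ x ∈ J, u x ≠ 0)
    (hn : ¬ ∃ k, ∀ x ∈ J, v x = k * u x) :
    ∃ c1 c2, ∀ x ∈ J, w x = c1 * u x + c2 * v x :=
  wr_basis hJ hc hL hu hv hw (wr_nonprop hJ hc hu hv h0 hn)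

lemma wr_all {J : Set ℝ} (hJ : IsOpen J) (hc : IsPreconnected J) {P Q u u' v v' L : ℝ → ℝ}
    (hL : ∀ x ∈ J, HasDerivAt L (-P x) x) (hu : Sol J P Q u u') (hv : Sol J P Q v v')
    (hW : ∃ x ∈ J, u x * v' x - u' x * v x ≠ 0) : ∀ x ∈ J, u x * v' x - u' x * v x ≠ 0 := by
  obtain ⟨k, hk⟩ := wr_const hJ hc hL hu hv
  obtain ⟨x0, hx0, h0⟩ := hW
  have hk0 : k ≠ 0 := by
    rw [← hk x0 hx0]
    exact mul_ne_zero (Real.exp_pos _).ne' h0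
  intro x hx h
  apply hk0
  rw [← hk x hx, h, mul_zero]


noncomputable def pw (s x : ℝ) : ℝ := Real.exp (s * Real.log x)

lemma pw_pos (s x : ℝ) : 0 < pw s x := Real.exp_pos _

lemma pw_neg (s x : ℝ) : pw s (-x) = pw s x := by simp [pw]

lemma pw_mul (s : ℝ) {x y : ℝ} (hx : x ≠ 0) (hy : y ≠ 0) : pw s (x*y) = pw s x * pw s y := by
  simp only [pw]
  rw [Real.log_mul hx hy, ← Real.exp_add]; ring_nf

lemma pw_div (s : ℝ) {x y : ℝ} (hx : x ≠ 0) (hy : y ≠ 0) : pw s (x/y) = pw s x / pw s y := by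
  simp only [pw]
  rw [Real.log_div hx hy, ← Real.exp_sub]; ring_nf

lemma pw_pow (s x : ℝ) (n : ℕ) : pw s (x^n) = pw (s*n) x := by
  simp only [pw, Real.log_pow]; ring_nf

lemma pw_add (s t x : ℝ) : pw (s+t) x = pw s x * pw t x := by
  simp only [pw, ← Real.exp_add]; ring_nf

lemma pw_neg_exp (s x : ℝ) : pw (-s) x = (pw s x)⁻¹ := by
  simp only [pw, ← Real.exp_neg]; ring_nf

lemma pw_pow' (s x : ℝ) (n : ℕ) : (pw s x)^n = pw (s*n) x := by
  simp only [pw, ← Real.exp_nat_mul]; ring_nf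

lemma pw_one {x : ℝ} (hx : x ≠ 0) : pw 1 x = |x| := by
  simp [pw, Real.exp_log_eq_abs hx]

lemma pw_rpow (s : ℝ) {x : ℝ} (hx : 0 < x) : pw s x = x ^ s := by
  rw [pw, Real.rpow_def_of_pos hx, mul_comm]

lemma pw_hasDerivAt (s : ℝ) {x : ℝ} (hx : x ≠ 0) : HasDerivAt (pw s) (pw s x * (s / x)) x := by
  have := ((Real.hasDerivAt_log hx).const_mul s).exp
  exact this

lemma pw_analyticAt (s : ℝ) {x : ℝ} (hx : 0 < x) : AnalyticAt ℝ (pw s) x := by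
  exact (analyticAt_const.mul (analyticAt_log hx)).rexp

/-! The ODE in `H`. -/
noncomputable def PG (H : ℝ) : ℝ := -(4/3)*H/(H^2-1)
noncomputable def QG (H : ℝ) : ℝ := -(4/225)/(H^2-1)
noncomputable def LG (H : ℝ) : ℝ := (2/3)*Real.log (H^2-1)

lemma LG_hasDerivAt {H : ℝ} (h : H^2-1 ≠ 0) : HasDerivAt LG (-PG H) H := by
  have h1 : HasDerivAt (fun H : ℝ => H^2-1) (2*H) H := by
    simpa using (hasDerivAt_pow 2 H).sub_const 1
  have := (h1.log h).const_mul (2/3)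
  refine this.congr_deriv ?_
  unfold PG
  field_simp
  ring

noncomputable def k1 (H : ℝ) : ℝ := twoFone (1/15) (4/15) (2/3) ((1-H)/2)
noncomputable def k1' (H : ℝ) : ℝ := -(1/2) * F1 (1/15) (4/15) (2/3) ((1-H)/2)
noncomputable def k2 (H : ℝ) : ℝ := pw (1/3) ((1-H)/2) * twoFone (2/5) (3/5) (4/3) ((1-H)/2)
noncomputable def k2' (H : ℝ) : ℝ := pw (1/3) ((1-H)/2) *
  (-(1/2) * F1 (2/5) (3/5) (4/3) ((1-H)/2) + (1/3) / (H-1) * twoFone (2/5) (3/5) (4/3) ((1-H)/2))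
noncomputable def Y1 (H : ℝ) : ℝ := pw (-(1/15)) H * twoFone (1/30) (8/15) (9/10) (1/H^2)
noncomputable def Y1' (H : ℝ) : ℝ := pw (-(1/15)) H *
  (-(1/15) / H * twoFone (1/30) (8/15) (9/10) (1/H^2) - 2/H^3 * F1 (1/30) (8/15) (9/10) (1/H^2))
noncomputable def Y2 (H : ℝ) : ℝ := pw (-(4/15)) H * twoFone (2/15) (19/30) (11/10) (1/H^2)
noncomputable def Y2' (H : ℝ) : ℝ := pw (-(4/15)) H *
  (-(4/15) / H * twoFone (2/15) (19/30) (11/10) (1/H^2) - 2/H^3 * F1 (2/15) (19/30) (11/10) (1/H^2))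

lemma xi_deriv (H : ℝ) : HasDerivAt (fun H : ℝ => (1-H)/2) (-(1/2)) H := by
  have := ((hasDerivAt_id H).const_sub 1).div_const 2
  refine this.congr_deriv (by norm_num)

lemma xi_abs {H : ℝ} (h1 : -1 < H) (h2 : H < 3) : |(1-H)/2| < 1 := by
  rw [abs_lt]; constructor <;> linarith

lemma k1_sol : Sol ({H | -1 < H ∧ H < 3 ∧ H ≠ 1}) PG QG k1 k1' := by
  rintro H ⟨h1, h2, h3⟩
  have hx := xi_abs h1 h2
  have d0 := (F_hasDerivAt (a := 1/15) (b := 4/15) (c := 2/3) (by norm_num) (by norm_num) (by norm_num) hx).comp H (xi_deriv H)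
  have d1 := ((F1_hasDerivAt (a := 1/15) (b := 4/15) (c := 2/3) (by norm_num) (by norm_num) (by norm_num) hx).comp H (xi_deriv H)).const_mul (-(1/2))
  have ode := F_ode (a := 1/15) (b := 4/15) (c := 2/3) (by norm_num) (by norm_num) (by norm_num) hx
  refine ⟨d0.congr_deriv ?_, d1.congr_deriv ?_⟩
  · unfold k1' F1; ring
  · unfold PG QG k1 k1'
    have h4 : H^2 - 1 ≠ 0 := by
      have : (H-1)*(H+1) ≠ 0 := mul_ne_zero (sub_ne_zero.2 h3) (by linarith)
      intro h; apply this; linarith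
    generalize F2 (1/15) (4/15) (2/3) ((1-H)/2) = f2 at *
    generalize F1 (1/15) (4/15) (2/3) ((1-H)/2) = f1 at *
    generalize twoFone (1/15) (4/15) (2/3) ((1-H)/2) = f0 at *
    field_simp
    linear_combination (-2700)*ode

lemma k2_sol : Sol ({H | -1 < H ∧ H < 3 ∧ H ≠ 1}) PG QG k2 k2' := by
  rintro H ⟨h1, h2, h3⟩
  have hx := xi_abs h1 h2
  have hne : (1-H)/2 ≠ 0 := by
    intro h; apply h3; linarith
  have hne' : H - 1 ≠ 0 := sub_ne_zero.2 h3
  have d0 := (F_hasDerivAt (a := 2/5) (b := 3/5) (c := 4/3) (by norm_num) (by norm_num) (by norm_num) hx).comp H (xi_deriv H)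
  have d1 := ((F1_hasDerivAt (a := 2/5) (b := 3/5) (c := 4/3) (by norm_num) (by norm_num) (by norm_num) hx).comp H (xi_deriv H)).const_mul (-(1/2))
  have dp := (pw_hasDerivAt (1/3) hne).comp H (xi_deriv H)
  have di : HasDerivAt (fun H : ℝ => (1/3)/(H-1)) (-(1/3)/(H-1)^2) H := by
    refine ((hasDerivAt_const H (1/3:ℝ)).div ((hasDerivAt_id H).sub_const 1) hne').congr_deriv ?_
    simp
  have ode := F_ode (a := 2/5) (b := 3/5) (c := 4/3) (by norm_num) (by norm_num) (by norm_num) hx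
  refine ⟨(dp.mul d0).congr_deriv ?_, (dp.mul (d1.add (di.mul d0))).congr_deriv ?_⟩
  · unfold k2' F1
    simp only [Function.comp_apply]
    have : (1 - H) ≠ 0 := by intro h; apply h3; linarith
    have : (1/3 / ((1 - H)/2) * (-(1/2)):ℝ) = 1/3/(H-1) := by
      field_simp; ring
    linear_combination (pw (1/3) ((1-H)/2) * twoFone (2/5) (3/5) (4/3) ((1-H)/2)) * this
  · unfold PG QG k2 k2'
    simp only [Function.comp_apply, Pi.mul_apply, Pi.add_apply]
    have h5 : H + 1 ≠ 0 := by linarith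
    have h4 : H^2 - 1 = (H-1)*(H+1) := by ring
    rw [h4]
    have h6 : (1 - H) = -(H-1) := by ring
    change _ * ((-(1/2)) * F1 (2/5) (3/5) (4/3) ((1-H)/2) + _) + _ * (_ + (_ * _ + _ * (F1 (2/5) (3/5) (4/3) ((1-H)/2) * _))) = _
    generalize F2 (2/5) (3/5) (4/3) ((1-H)/2) = f2 at *
    generalize F1 (2/5) (3/5) (4/3) ((1-H)/2) = f1 at *
    generalize twoFone (2/5) (3/5) (4/3) ((1-H)/2) = f0 at *
    generalize pw (1/3) ((1-H)/2) = p at *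
    rw [h6]
    field_simp
    linear_combination (8100*(1-H)*p)*ode

lemma xH_deriv {H : ℝ} (h : H ≠ 0) : HasDerivAt (fun H : ℝ => 1/H^2) (-2/H^3) H := by
  refine ((hasDerivAt_const H (1:ℝ)).div (hasDerivAt_pow 2 H) (by positivity)).congr_deriv ?_
  field_simp
  simp
  ring

lemma xH_abs {H : ℝ} (h : 1 < H) : |1/H^2| < 1 := by
  rw [abs_of_nonneg (by positivity), div_lt_one (by positivity)]
  nlinarith

lemma Y1_sol : Sol (Set.Ioi 1) PG QG Y1 Y1' := by
  intro H hH
  have hH1 : 1 < H := hH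
  have hx := xH_abs hH1
  have h0 : H ≠ 0 := by positivity
  have d0 := (F_hasDerivAt (a := 1/30) (b := 8/15) (c := 9/10) (by norm_num) (by norm_num) (by norm_num) hx).comp H (xH_deriv h0)
  have d1 := (F1_hasDerivAt (a := 1/30) (b := 8/15) (c := 9/10) (by norm_num) (by norm_num) (by norm_num) hx).comp H (xH_deriv h0)
  have dp := pw_hasDerivAt (-(1/15)) h0
  have di : HasDerivAt (fun H : ℝ => -(1/15)/H) ((1/15)/H^2) H := by
    refine ((hasDerivAt_const H (-(1/15):ℝ)).div (hasDerivAt_id H) h0).congr_deriv ?_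
    simp
  have dj : HasDerivAt (fun H : ℝ => 2/H^3) (-6/H^4) H := by
    refine ((hasDerivAt_const H (2:ℝ)).div (hasDerivAt_pow 3 H) (by positivity)).congr_deriv ?_
    field_simp
    push_cast
    ring
  have ode := F_ode (a := 1/30) (b := 8/15) (c := 9/10) (by norm_num) (by norm_num) (by norm_num) hx
  refine ⟨(dp.mul d0).congr_deriv ?_, (dp.mul ((di.mul d0).sub (dj.mul d1))).congr_deriv ?_⟩
  · unfold Y1' F1
    simp only [Function.comp_apply]
    ring
  · unfold PG QG Y1 Y1'
    simp only [Function.comp_apply, Pi.mul_apply, Pi.sub_apply]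
    have h4 : H^2 - 1 ≠ 0 := by nlinarith
    change _ * _ + _ * ((_ + _ * (F1 (1/30) (8/15) (9/10) (1/H^2) * _)) - _) = _
    generalize F2 (1/30) (8/15) (9/10) (1/H^2) = f2 at *
    generalize F1 (1/30) (8/15) (9/10) (1/H^2) = f1 at *
    generalize twoFone (1/30) (8/15) (9/10) (1/H^2) = f0 at *
    generalize pw (-(1/15)) H = p at *
    field_simp at ode ⊢
    linear_combination (135*p)*ode

lemma Y2_sol : Sol (Set.Ioi 1) PG QG Y2 Y2' := by
  intro H hH
  have hH1 : 1 < H := hH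
  have hx := xH_abs hH1
  have h0 : H ≠ 0 := by positivity
  have d0 := (F_hasDerivAt (a := 2/15) (b := 19/30) (c := 11/10) (by norm_num) (by norm_num) (by norm_num) hx).comp H (xH_deriv h0)
  have d1 := (F1_hasDerivAt (a := 2/15) (b := 19/30) (c := 11/10) (by norm_num) (by norm_num) (by norm_num) hx).comp H (xH_deriv h0)
  have dp := pw_hasDerivAt (-(4/15)) h0
  have di : HasDerivAt (fun H : ℝ => -(4/15)/H) ((4/15)/H^2) H := by
    refine ((hasDerivAt_const H (-(4/15):ℝ)).div (hasDerivAt_id H) h0).congr_deriv ?_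
    simp
  have dj : HasDerivAt (fun H : ℝ => 2/H^3) (-6/H^4) H := by
    refine ((hasDerivAt_const H (2:ℝ)).div (hasDerivAt_pow 3 H) (by positivity)).congr_deriv ?_
    field_simp
    push_cast
    ring
  have ode := F_ode (a := 2/15) (b := 19/30) (c := 11/10) (by norm_num) (by norm_num) (by norm_num) hx
  refine ⟨(dp.mul d0).congr_deriv ?_, (dp.mul ((di.mul d0).sub (dj.mul d1))).congr_deriv ?_⟩
  · unfold Y2' F1
    simp only [Function.comp_apply]
    ring
  · unfold PG QG Y2 Y2'
    simp only [Function.comp_apply, Pi.mul_apply, Pi.sub_apply]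
    have h4 : H^2 - 1 ≠ 0 := by nlinarith
    change _ * _ + _ * ((_ + _ * (F1 (2/15) (19/30) (11/10) (1/H^2) * _)) - _) = _
    generalize F2 (2/15) (19/30) (11/10) (1/H^2) = f2 at *
    generalize F1 (2/15) (19/30) (11/10) (1/H^2) = f1 at *
    generalize twoFone (2/15) (19/30) (11/10) (1/H^2) = f0 at *
    generalize pw (-(4/15)) H = p at *
    field_simp at ode ⊢
    linear_combination (135*p)*ode



lemma pw_abs (s : ℝ) {x : ℝ} (hx : x ≠ 0) : pw s x = |x| ^ s := by
  rw [← pw_rpow s (abs_pos.2 hx)]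
  simp [pw, Real.log_abs]

lemma F_cont0 {a b c : ℝ} (ha : 0 < a) (hb : 0 < b) (hc : 0 < c) : Tendsto (twoFone a b c) (𝓝 0) (𝓝 1) := by
  have h := (F_hasDerivAt ha hb hc (x := 0) (by simp)).continuousAt
  have h2 : Tendsto (twoFone a b c) (𝓝 0) (𝓝 (twoFone a b c 0)) := h
  rwa [F_zero] at h2

lemma pw_tendsto_zero {s : ℝ} (hs : 0 < s) : Tendsto (pw s) (𝓝[≠] 0) (𝓝 0) := by
  have h : Tendsto (fun x : ℝ => |x| ^ s) (𝓝[≠] 0) (𝓝 0) := by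
    have : ContinuousAt (fun x : ℝ => |x| ^ s) 0 :=
      (continuous_abs.continuousAt).rpow_const (Or.inr hs.le)
    have h2 : Tendsto (fun x : ℝ => |x| ^ s) (𝓝 0) (𝓝 (|(0:ℝ)| ^ s)) := this
    rw [abs_zero, Real.zero_rpow hs.ne'] at h2
    exact h2.mono_left nhdsWithin_le_nhds
  refine h.congr' ?_
  filter_upwards [self_mem_nhdsWithin] with x hx
  rw [pw_abs s hx]

lemma xi_tendsto : Tendsto (fun H : ℝ => (1-H)/2) (𝓝[≠] 1) (𝓝[≠] 0) := by
  rw [tendsto_nhdsWithin_iff]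
  constructor
  · have : ContinuousAt (fun H : ℝ => (1-H)/2) 1 := by fun_prop
    have h2 : Tendsto (fun H : ℝ => (1-H)/2) (𝓝 1) (𝓝 ((1-1)/2)) := this
    norm_num at h2
    exact h2.mono_left nhdsWithin_le_nhds
  · filter_upwards [self_mem_nhdsWithin] with x hx h
    apply hx
    simp at h ⊢
    linarith

lemma k1_tendsto : Tendsto k1 (𝓝[≠] 1) (𝓝 1) :=
  ((F_cont0 (by norm_num) (by norm_num) (by norm_num)).mono_left nhdsWithin_le_nhds).comp xi_tendsto

lemma k2F_tendsto : Tendsto (fun H : ℝ => twoFone (2/5) (3/5) (4/3) ((1-H)/2)) (𝓝[≠] 1) (𝓝 1) :=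
  ((F_cont0 (by norm_num) (by norm_num) (by norm_num)).mono_left nhdsWithin_le_nhds).comp xi_tendsto

lemma k2_tendsto : Tendsto k2 (𝓝[≠] 1) (𝓝 0) := by
  have := ((pw_tendsto_zero (s := 1/3) (by norm_num)).comp xi_tendsto).mul k2F_tendsto
  rw [zero_mul] at this
  exact this

lemma k2_pos_ev : ∀ᶠ H in 𝓝[≠] (1:ℝ), 0 < k2 H := by
  filter_upwards [k2F_tendsto.eventually (lt_mem_nhds (show (0:ℝ) < 1 by norm_num))] with H hH
  exact mul_pos (pw_pos _ _) hH

lemma Y1_pos {H : ℝ} (h : 1 < H) : 0 < Y1 H := by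
  have := xH_abs h
  rw [abs_of_nonneg (by positivity)] at this
  have := F_ge_one (a := 1/30) (b := 8/15) (c := 9/10) (by norm_num) (by norm_num) (by norm_num) (x := 1/H^2) (by positivity) this
  exact mul_pos (pw_pos _ _) (by linarith)

lemma Y2_pos {H : ℝ} (h : 1 < H) : 0 < Y2 H := by
  have := xH_abs h
  rw [abs_of_nonneg (by positivity)] at this
  have := F_ge_one (a := 2/15) (b := 19/30) (c := 11/10) (by norm_num) (by norm_num) (by norm_num) (x := 1/H^2) (by positivity) this
  exact mul_pos (pw_pos _ _) (by linarith)

lemma Y_nonprop : ¬ ∃ k, ∀ H ∈ Set.Ioi (1:ℝ), Y2 H = k * Y1 H := by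
  rintro ⟨k, hk⟩
  have hx : Tendsto (fun H : ℝ => 1/H^2) atTop (𝓝 0) := by
    have := tendsto_pow_neg_atTop (𝕜 := ℝ) (n := 2) (by norm_num)
    refine this.congr (fun x => ?_)
    rw [zpow_neg]; simp
  have t1 := (F_cont0 (a := 1/30) (b := 8/15) (c := 9/10) (by norm_num) (by norm_num) (by norm_num)).comp hx
  have t2 := (F_cont0 (a := 2/15) (b := 19/30) (c := 11/10) (by norm_num) (by norm_num) (by norm_num)).comp hx
  have t3 : Tendsto (fun H : ℝ => pw (-(1/5)) H) atTop (𝓝 0) := by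
    refine (tendsto_rpow_neg_atTop (y := 1/5) (by norm_num)).congr' ?_
    filter_upwards [eventually_gt_atTop 0] with x hx
    rw [pw_rpow _ hx]
  have t4 := t3.mul t2
  have t5 := t1.const_mul k
  have : (fun H : ℝ => pw (-(1/5)) H * (twoFone (2/15) (19/30) (11/10) ∘ fun H : ℝ => 1/H^2) H) =ᶠ[atTop]
     (fun H => k * (twoFone (1/30) (8/15) (9/10) ∘ fun H : ℝ => 1/H^2) H) := by
    filter_upwards [eventually_gt_atTop 1] with H hH
    have := hk H hH
    unfold Y1 Y2 at this
    rw [show (-(4/15):ℝ) = -(1/5) + -(1/15) by norm_num, pw_add] at this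
    have hp := pw_pos (-(1/15)) H
    simp only [Function.comp_apply]
    apply mul_left_cancel₀ hp.ne'
    linear_combination this
  have h0 := tendsto_nhds_unique (t4.congr' this) t5
  have h2 := hk 2 (by norm_num)
  have := Y2_pos (H := 2) (by norm_num)
  simp at h0
  rw [h2, ← h0] at this
  simp at this

lemma H1 : ∃ α β γ δ : ℝ, (∀ H ∈ Set.Ioo (1:ℝ) 3, k1 H = α * Y1 H + β * Y2 H) ∧
    (∀ H ∈ Set.Ioo (1:ℝ) 3, k2 H = γ * Y1 H + δ * Y2 H) ∧ ¬ (α = 0 ∧ γ = 0) := by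
  have hL : ∀ x ∈ Set.Ioi (1:ℝ), HasDerivAt LG (-PG x) x := fun x hx => LG_hasDerivAt (by
    have : 1 < x := hx
    nlinarith)
  have hW := wr_all isOpen_Ioi isPreconnected_Ioi hL Y1_sol Y2_sol
    (wr_nonprop isOpen_Ioi isPreconnected_Ioi Y1_sol Y2_sol (fun x hx => (Y1_pos hx).ne') Y_nonprop)
  have sub : Set.Ioo (1:ℝ) 3 ⊆ Set.Ioi 1 := fun x hx => hx.1
  have sub2 : Set.Ioo (1:ℝ) 3 ⊆ {H | -1 < H ∧ H < 3 ∧ H ≠ 1} := fun x hx => ⟨by linarith [hx.1], hx.2, hx.1.ne'⟩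
  have hW2 : ∃ x ∈ Set.Ioo (1:ℝ) 3, Y1 x * Y2' x - Y1' x * Y2 x ≠ 0 :=
    ⟨2, by norm_num, hW 2 (by norm_num)⟩
  obtain ⟨α, β, h1⟩ := wr_basis isOpen_Ioo isPreconnected_Ioo (fun x hx => hL x (sub hx)) (Y1_sol.mono sub) (Y2_sol.mono sub) (k1_sol.mono sub2) hW2
  obtain ⟨γ, δ, h2⟩ := wr_basis isOpen_Ioo isPreconnected_Ioo (fun x hx => hL x (sub hx)) (Y1_sol.mono sub) (Y2_sol.mono sub) (k2_sol.mono sub2) hW2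
  refine ⟨α, β, γ, δ, h1, h2, ?_⟩
  rintro ⟨rfl, rfl⟩
  have hle : 𝓝[>] (1:ℝ) ≤ 𝓝[≠] 1 := nhdsWithin_mono _ (fun x hx => ne_of_gt hx)
  have t1 := (k1_tendsto.mono_left hle).const_mul δ
  have t2 := (k2_tendsto.mono_left hle).const_mul β
  have hev : ∀ᶠ H in 𝓝[>] (1:ℝ), H ∈ Set.Ioo (1:ℝ) 3 := Ioo_mem_nhdsGT (by norm_num)
  have hd := tendsto_nhds_unique (t1.congr' (by
    filter_upwards [hev] with H hH
    rw [h1 H hH]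
    show _ = β * k2 H
    rw [h2 H hH]; ring)) t2
  simp at hd
  obtain ⟨H, hH, hp⟩ := (hev.and (hle k2_pos_ev)).exists
  rw [h2 H hH, hd] at hp
  simp at hp

lemma Sol_neg {k k' : ℝ → ℝ} (h : Sol (Set.Ioo (-1) 1) PG QG k k') :
    Sol (Set.Ioo (-1) 1) PG QG (fun H => k (-H)) (fun H => -k' (-H)) := by
  intro H hH
  have hm : -H ∈ Set.Ioo (-1:ℝ) 1 := ⟨by linarith [hH.2], by linarith [hH.1]⟩
  obtain ⟨a, b⟩ := h _ hm
  have d0 := a.comp H (hasDerivAt_neg H)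
  have d1 := (b.comp H (hasDerivAt_neg H)).neg
  refine ⟨d0.congr_deriv (by ring), d1.congr_deriv ?_⟩
  unfold PG QG
  ring

lemma H2 : ∃ a b c : ℝ, a = ∑' n, tc (1/15) (4/15) (2/3) n ∧ a^2 + b*c = 1 ∧
    (∀ H ∈ Set.Ioo (-1:ℝ) 1, k1 H = a * k1 (-H) + b * k2 (-H)) ∧
    (∀ H ∈ Set.Ioo (-1:ℝ) 1, k2 H = c * k1 (-H) - a * k2 (-H)) := by
  have hL : ∀ x ∈ Set.Ioo (-1:ℝ) 1, HasDerivAt LG (-PG x) x := fun x hx => LG_hasDerivAt (by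
    have := hx.1
    have := hx.2
    nlinarith)
  have sub2 : Set.Ioo (-1:ℝ) 1 ⊆ {H | -1 < H ∧ H < 3 ∧ H ≠ 1} := fun x hx => ⟨hx.1, by linarith [hx.2], hx.2.ne⟩
  have hs1 := k1_sol.mono sub2
  have hs2 := k2_sol.mono sub2
  have k1pos : ∀ H ∈ Set.Ioo (-1:ℝ) 1, 0 < k1 H := by
    intro H hH
    have := F_ge_one (a := 1/15) (b := 4/15) (c := 2/3) (by norm_num) (by norm_num) (by norm_num) (x := (1-H)/2) (by linarith [hH.2]) (by linarith [hH.1])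
    unfold k1; linarith
  have k2pos : ∀ H ∈ Set.Ioo (-1:ℝ) 1, 0 < k2 H := by
    intro H hH
    have := F_ge_one (a := 2/5) (b := 3/5) (c := 4/3) (by norm_num) (by norm_num) (by norm_num) (x := (1-H)/2) (by linarith [hH.2]) (by linarith [hH.1])
    exact mul_pos (pw_pos _ _) (by linarith)
  have hle : 𝓝[<] (1:ℝ) ≤ 𝓝[≠] 1 := nhdsWithin_mono _ (fun x hx => ne_of_lt hx)
  have hev : ∀ᶠ H in 𝓝[<] (1:ℝ), H ∈ Set.Ioo (-1:ℝ) 1 := Ioo_mem_nhdsLT (by norm_num)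
  have indep : ∀ x y : ℝ, (∀ H ∈ Set.Ioo (-1:ℝ) 1, x * k1 H + y * k2 H = 0) → x = 0 ∧ y = 0 := by
    intro x y h
    have t := ((k1_tendsto.mono_left hle).const_mul x).add ((k2_tendsto.mono_left hle).const_mul y)
    have hx : x = 0 := by
      have := tendsto_nhds_unique (t.congr' (by
        filter_upwards [hev] with H hH
        exact h H hH)) tendsto_const_nhds
      simpa using this
    refine ⟨hx, ?_⟩
    have h0 := h 0 (by norm_num)
    have := k2pos 0 (by norm_num)
    rw [hx, zero_mul, zero_add] at h0
    exact (mul_eq_zero.1 h0).resolve_right this.ne'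
  have nonprop : ¬ ∃ k, ∀ x ∈ Set.Ioo (-1:ℝ) 1, k2 x = k * k1 x := by
    rintro ⟨k, hk⟩
    have := (indep k (-1) (fun H hH => by rw [hk H hH]; ring)).2
    norm_num at this
  obtain ⟨a, b, h1⟩ := wr_span isOpen_Ioo isPreconnected_Ioo hL hs1 hs2 (Sol_neg hs1) (fun x hx => (k1pos x hx).ne') nonprop
  obtain ⟨c, d, h2⟩ := wr_span isOpen_Ioo isPreconnected_Ioo hL hs1 hs2 (Sol_neg hs2) (fun x hx => (k1pos x hx).ne') nonprop
  have hneg : ∀ H ∈ Set.Ioo (-1:ℝ) 1, -H ∈ Set.Ioo (-1:ℝ) 1 := fun H hH => ⟨by linarith [hH.2], by linarith [hH.1]⟩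
  have ha : a = ∑' n, tc (1/15) (4/15) (2/3) n := by
    have t := ((k1_tendsto.mono_left hle).const_mul a).add ((k2_tendsto.mono_left hle).const_mul b)
    have hm : Tendsto (fun H : ℝ => (1+H)/2) (𝓝[<] 1) (𝓝[<] 1) := by
      rw [tendsto_nhdsWithin_iff]
      constructor
      · have : ContinuousAt (fun H : ℝ => (1+H)/2) 1 := by fun_prop
        have h2 : Tendsto (fun H : ℝ => (1+H)/2) (𝓝 1) (𝓝 ((1+1)/2)) := this
        norm_num at h2
        exact h2.mono_left nhdsWithin_le_nhds
      · filter_upwards [self_mem_nhdsWithin] with x hx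
        simp at hx ⊢
        linarith
    have t2 := gauss_tendsto.comp hm
    have := tendsto_nhds_unique (t.congr' (by
        filter_upwards [hev] with H hH
        rw [← h1 H hH]
        simp only [k1, sub_neg_eq_add]
        rfl)) t2
    simpa using this
  have ha1 : 1 < a := by
    rw [ha]
    have hs := tc_summable_one (a := 1/15) (b := 4/15) (c := 2/3) (by norm_num) (by norm_num) (by norm_num) (by norm_num)
    rw [hs.tsum_eq_zero_add, tc_zero]
    have := ((summable_nat_add_iff 1).2 hs).tsum_pos (fun n => (tc_pos (by norm_num) (by norm_num) (by norm_num) _).le) 0 (tc_pos (by norm_num) (by norm_num) (by norm_num) _)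
    linarith
  obtain ⟨e1, e2⟩ := indep (a^2+b*c-1) (b*(a+d)) (fun H hH => by
    have q1 := h1 H hH
    have q2 := h1 (-H) (hneg H hH)
    have q3 := h2 H hH
    rw [neg_neg] at q2
    rw [q1, q3] at q2
    linear_combination -q2)
  obtain ⟨e3, e4⟩ := indep (c*(a+d)) (b*c+d^2-1) (fun H hH => by
    have q1 := h1 H hH
    have q2 := h2 (-H) (hneg H hH)
    have q3 := h2 H hH
    rw [neg_neg] at q2
    rw [q1, q3] at q2
    linear_combination -q2)
  have hd : d = -a := by
    by_contra hne
    have hne' : a + d ≠ 0 := by intro h; apply hne; linarith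
    have hb : b = 0 := (mul_eq_zero.1 e2).resolve_right hne'
    rw [hb] at e1
    nlinarith
  refine ⟨a, b, c, ha, by linarith, fun H hH => ?_, fun H hH => ?_⟩
  · have := h1 (-H) (hneg H hH)
    rwa [neg_neg] at this
  · have := h2 (-H) (hneg H hH)
    rw [neg_neg, hd] at this
    linarith


lemma poly5 (c0 c1 c2 c3 c4 c5 m : ℝ) :
    HasDerivAt (fun m : ℝ => c0 + c1*m + c2*m^2 + c3*m^3 + c4*m^4 + c5*m^5) (c1 + 2*c2*m + 3*c3*m^2 + 4*c4*m^3 + 5*c5*m^4) m := by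
  have h1 := (hasDerivAt_id m).const_mul c1
  have h2 := (hasDerivAt_pow 2 m).const_mul c2
  have h3 := (hasDerivAt_pow 3 m).const_mul c3
  have h4 := (hasDerivAt_pow 4 m).const_mul c4
  have h5 := (hasDerivAt_pow 5 m).const_mul c5
  refine ((((((hasDerivAt_const m c0).add h1).add h2).add h3).add h4).add h5).congr_deriv ?_
  push_cast
  ring

noncomputable def nn (m : ℝ) : ℝ := Real.sqrt (100*m^4+205*m^2+100)
noncomputable def ee (m : ℝ) : ℝ := 5*m/(nn m + 10*m^2+10)
noncomputable def pp (m : ℝ) : ℝ := m * ee m + 20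
noncomputable def NN (m : ℝ) : ℝ := ((1331*m^5-1920*m^4+3310*m^3-3310*m^2+1920*m-1331) - (125*m^3-30*m^2-30*m+125) * nn m)/81
noncomputable def RR (m : ℝ) : ℝ := (10*nn m - 250 - 300*m^2)/9
noncomputable def gp (m e : ℝ) : ℝ := (6875/2)*m^0*e^0 + (-125/2)*m^0*e^1 + (-7875/4)*m^1*e^0 + (375)*m^1*e^1 + (-25/4)*m^1*e^2 + (13375/4)*m^2*e^0 + (-375/2)*m^2*e^1 + (75/4)*m^2*e^2 + (-1250)*m^3*e^0 + (375)*m^3*e^1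
noncomputable def gpm (m e : ℝ) : ℝ := (-7875/4)*m^0*e^0 + (375)*m^0*e^1 + (-25/4)*m^0*e^2 + (13375/2)*m^1*e^0 + (-375)*m^1*e^1 + (75/2)*m^1*e^2 + (-3750)*m^2*e^0 + (1125)*m^2*e^1
noncomputable def gpe (m e : ℝ) : ℝ := (-125/2)*m^0*e^0 + (375)*m^1*e^0 + (-25/2)*m^1*e^1 + (-375/2)*m^2*e^0 + (75/2)*m^2*e^1 + (375)*m^3*e^0
noncomputable def GG (m : ℝ) : ℝ := gp m (ee m)
noncomputable def cc : ℝ := 253125/2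

lemma nn_pos (m : ℝ) : 0 < nn m := Real.sqrt_pos.2 (by positivity)
lemma nn_sq (m : ℝ) : nn m ^ 2 = 100*m^4+205*m^2+100 := Real.sq_sqrt (by positivity)
lemma qq_pos (m : ℝ) : 0 < nn m + 10*m^2+10 := by have := nn_pos m; positivity

lemma nn_eq (m : ℝ) : nn m = m * ee m + 10*m^2+10 := by
  have h := qq_pos m
  have h2 := nn_sq m
  have h3 : ee m * (nn m + 10*m^2+10) = 5*m := div_mul_cancel₀ _ h.ne'
  have : (nn m - (m * ee m + 10*m^2+10)) * (nn m + 10*m^2+10) = 0 := by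
    linear_combination h2 - m*h3
  have := (mul_eq_zero.1 this).resolve_right h.ne'
  linarith

lemma rel (m : ℝ) : m * (ee m)^2 + 20*(m^2+1)*ee m - 5*m = 0 := by
  have h := qq_pos m
  have h2 := nn_eq m
  have h3 : ee m * (nn m + 10*m^2+10) = 5*m := div_mul_cancel₀ _ h.ne'
  rw [h2] at h3
  linear_combination h3

lemma pp_pos (m : ℝ) : 0 < pp m := by
  have h := qq_pos m
  have : m * ee m = 5*m^2/(nn m + 10*m^2+10) := by unfold ee; ring
  unfold pp
  rw [this]
  positivity

lemma nn_hasDerivAt (m : ℝ) : HasDerivAt nn ((200*m^3+205*m)/nn m) m := by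
  have h := (poly5 100 0 205 0 100 0 m).sqrt (by have : (0:ℝ) < 100*m^4+205*m^2+100 := by positivity
                                                 intro h; linarith)
  have e : nn = fun m : ℝ => Real.sqrt (100 + 0*m + 205*m^2 + 0*m^3+100*m^4+0*m^5) := by
    funext x; unfold nn; congr 1; ring
  have e2 : Real.sqrt (100 + 0*m + 205*m^2 + 0*m^3+100*m^4+0*m^5) = nn m := by rw [e]
  rw [e2] at h
  have := nn_pos m
  rw [← e] at h
  refine h.congr_deriv ?_
  field_simp
  ring

lemma ee_hasDerivAt (m : ℝ) : HasDerivAt ee ((5 - (ee m)^2 - 40*m*ee m)/(2*nn m)) m := by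
  have h0 := qq_pos m
  have hn := nn_pos m
  have d := ((hasDerivAt_id m).const_mul 5).div (((nn_hasDerivAt m).add ((hasDerivAt_pow 2 m).const_mul 10)).add_const 10) h0.ne'
  refine d.congr_deriv ?_
  have h1 := rel m
  have h2 := nn_eq m
  have h3 : ee m * (nn m + 10*m^2+10) = 5*m := div_mul_cancel₀ _ h0.ne'
  simp only [id, Pi.add_apply]
  push_cast
  field_simp
  generalize ee m = e at *
  generalize nn m = n at *
  subst h2
  linear_combination ((20)*m^0*e^1 + (810)*m^1*e^0 + (1)*m^1*e^2 + (60)*m^2*e^1 + (800)*m^3*e^0)*h1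

lemma pp_hasDerivAt (m : ℝ) : HasDerivAt pp (pp m * ee m / nn m) m := by
  refine (((hasDerivAt_id m).mul (ee_hasDerivAt m)).add_const 20).congr_deriv ?_
  have hn := nn_pos m
  have h1 := rel m
  have h2 := nn_eq m
  simp only [id]
  unfold pp
  field_simp
  rw [h2]
  linear_combination -h1

lemma GG_hasDerivAt (m : ℝ) : HasDerivAt GG (gpm m (ee m) + gpe m (ee m) * ((5 - (ee m)^2 - 40*m*ee m)/(2*nn m))) m := by
  have h0 := poly5 (6875/2) (-7875/4) (13375/4) (-1250) (0) (0) m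
  have h1 := poly5 (-125/2) (375) (-375/2) (375) (0) (0) m
  have h2 := poly5 (0) (-25/4) (75/4) (0) (0) (0) m
  have d := (h0.add (h1.mul (ee_hasDerivAt m))).add (h2.mul ((ee_hasDerivAt m).pow 2))
  refine (d.congr_of_eventuallyEq (Eventually.of_forall (fun m => ?_))).congr_deriv ?_
  · show gp m (ee m) = _
    unfold gp
    simp only [Pi.add_apply, Pi.mul_apply, Pi.pow_apply]
    ring
  · unfold gpm gpe
    simp only [Pi.add_apply, Pi.mul_apply, Pi.pow_apply]
    push_cast
    ring

lemma GG_def (m : ℝ) : GG m = (225/4)*(-(200*m^3+205*m)*(m+1)/3 + 4*nn m^2/9 - (m+1)*nn m * ee m/9 - (m+1)^2*RR m) := by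
  unfold GG gp RR
  rw [nn_eq m]
  ring

lemma id_C (m : ℝ) : cc * ((1331*5*m^4-1920*4*m^3+3310*3*m^2-3310*2*m+1920)*nn m - (125*3*m^2-30*2*m-30)*nn m^2 - (125*m^3-30*m^2-30*m+125)*(200*m^3+205*m))/81*(m+1) - cc*5*nn m*NN m = pp m * GG m^2 := by
  have h1 := rel m
  unfold cc NN pp GG gp
  rw [nn_eq m]
  generalize ee m = e at *
  linear_combination ((859375/2)*m^0*e^0 + (-15625/4)*m^0*e^1 + (-6890625/4)*m^1*e^0 + (359375/4)*m^1*e^1 + (-3125/4)*m^1*e^2 + (4484375/2)*m^2*e^0 + (-5084375/16)*m^2*e^1 + (28125/4)*m^2*e^2 + (-625/16)*m^2*e^3 + (-15328125/4)*m^3*e^0 + (2059375/8)*m^3*e^1 + (-15625)*m^3*e^2 + (1875/8)*m^3*e^3 + (3515625/2)*m^4*e^0 + (-4596875/16)*m^4*e^1 + (28125/4)*m^4*e^2 + (-5625/16)*m^4*e^3 + (-78125)*m^5*e^0 + (46875)*m^5*e^1 + (-28125/4)*m^5*e^2)*h1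

lemma id_D (m : ℝ) : cc^2*(NN m^2 - (m+1)^10) = pp m^2 * GG m^3 := by
  have h1 := rel m
  unfold cc NN pp GG gp
  rw [nn_eq m]
  generalize ee m = e at *
  linear_combination ((88623046875/2)*m^0*e^0 + (-1611328125/2)*m^0*e^1 + (9765625/2)*m^0*e^2 + (-1277197265625/4)*m^1*e^0 + (16777343750)*m^1*e^1 + (-2314453125/8)*m^1*e^2 + (13671875/8)*m^1*e^3 + (2204111328125/4)*m^2*e^0 + (-294462890625/4)*m^2*e^1 + (45396484375/16)*m^2*e^2 + (-169921875/4)*m^2*e^3 + (3515625/16)*m^2*e^4 + (-3971748046875/4)*m^3*e^0 + (846611328125/8)*m^3*e^1 + (-279228515625/32)*m^3*e^2 + (8687109375/32)*m^3*e^3 + (-104296875/32)*m^3*e^4 + (390625/32)*m^3*e^5 + (3997634765625/4)*m^4*e^0 + (-1282306640625/8)*m^4*e^1 + (715686328125/64)*m^4*e^2 + (-10166015625/16)*m^4*e^3 + (487890625/32)*m^4*e^4 + (-2109375/16)*m^4*e^5 + (15625/64)*m^4*e^6 + (-2928544921875/4)*m^5*e^0 + (983302734375/8)*m^5*e^1 +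 (-959164453125/64)*m^5*e^2 + (5489453125/8)*m^5*e^3 + (-890390625/32)*m^5*e^4 + (3828125/8)*m^5*e^5 + (-140625/64)*m^5*e^6 + (362519531250)*m^6*e^0 + (-692806640625/8)*m^6*e^1 + (606913671875/64)*m^6*e^2 + (-12530859375/16)*m^6*e^3 + (748203125/32)*m^6*e^4 + (-10546875/16)*m^6*e^5 + (421875/64)*m^6*e^6 + (-280224609375/4)*m^7*e^0 + (33769531250)*m^7*e^1 + (-389248828125/64)*m^7*e^2 + (11406640625/32)*m^7*e^3 + (-177890625/8)*m^7*e^4 + (10546875/32)*m^7*e^5 + (-421875/64)*m^7*e^6 + (7861328125/2)*m^8*e^0 + (-8642578125/2)*m^8*e^1 + (12564453125/8)*m^8*e^2 + (-812109375/4)*m^8*e^3 + (10546875/2)*m^8*e^4 + (-2109375/8)*m^8*e^5 + (97656250)*m^9*e^1 + (-87890625)*m^9*e^2 + (52734375/2)*m^9*e^3 + (-10546875/4)*m^9*e^4)*h1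

lemma id_B (m : ℝ) : pp m * (6*(m+1)*(gpm m (ee m) * nn m + gpe m (ee m) * (5 - (ee m)^2 - 40*m*ee m)/2) + (4*(m+1)*ee m - 20*nn m)*GG m) = 4*cc*NN m := by
  have h1 := rel m
  unfold cc NN pp GG gp gpm gpe
  rw [nn_eq m]
  generalize ee m = e at *
  linear_combination ((48750)*m^0*e^0 + (-875/2)*m^0*e^1 + (-143750)*m^1*e^0 + (13875/2)*m^1*e^1 + (-25)*m^1*e^2 + (131250)*m^2*e^0 + (-14375/2)*m^2*e^1 + (575/2)*m^2*e^2 + (-77500)*m^3*e^0 + (5625/2)*m^3*e^1 + (-375/2)*m^3*e^2 + (1250)*m^4*e^0 + (-2625)*m^4*e^1)*h1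

noncomputable def Hf (m : ℝ) : ℝ := NN m / (m+1)^5
noncomputable def hp (m : ℝ) : ℝ := pp m * GG m^2 / (cc * (m+1)^6 * nn m)

lemma NN_hasDerivAt (m : ℝ) : HasDerivAt NN (((1331*5*m^4-1920*4*m^3+3310*3*m^2-3310*2*m+1920) - (125*3*m^2-30*2*m-30)*nn m - (125*m^3-30*m^2-30*m+125)*((200*m^3+205*m)/nn m))/81) m := by
  have h0 := poly5 (-1331) 1920 (-3310) 3310 (-1920) 1331 m
  have h1 := poly5 125 (-30) (-30) 125 0 0 m
  refine (((h0.sub (h1.mul (nn_hasDerivAt m))).div_const 81).congr_of_eventuallyEq (Eventually.of_forall (fun m => ?_))).congr_deriv ?_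
  · unfold NN
    simp only [Pi.sub_apply, Pi.mul_apply]
    ring
  · ring

lemma mp1_pow (k : ℕ) (m : ℝ) : HasDerivAt (fun m : ℝ => (m+1)^k) (k*(m+1)^(k-1)) m := by
  refine (((hasDerivAt_id m).add_const 1).pow k).congr_deriv ?_
  simp

lemma Hf_hasDerivAt {m : ℝ} (h : m + 1 ≠ 0) : HasDerivAt Hf (hp m) m := by
  refine ((NN_hasDerivAt m).div (mp1_pow 5 m) (by positivity)).congr_deriv ?_
  have hn := nn_pos m
  have hC := id_C m
  unfold hp
  rw [← hC]
  unfold cc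
  push_cast
  field_simp

lemma hp_hasDerivAt {m : ℝ} (h : m + 1 ≠ 0) : HasDerivAt hp
    (hp m * (2/(3*(m+1)) - (200*m^3+205*m)/nn m^2 - ee m/(3*nn m)) + (4/3)*Hf m * GG m/((m+1)^2*nn m^2)) m := by
  have hn := nn_pos m
  have hcc : cc ≠ 0 := by unfold cc; norm_num
  have d := ((pp_hasDerivAt m).mul ((GG_hasDerivAt m).pow 2)).div (((mp1_pow 6 m).const_mul cc).mul (nn_hasDerivAt m)) (by
    show cc * (m+1)^6 * nn m ≠ 0
    positivity)
  refine d.congr_deriv ?_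
  have hB := id_B m
  have hN : NN m = pp m * (6*(m+1)*(gpm m (ee m) * nn m + gpe m (ee m) * (5 - (ee m)^2 - 40*m*ee m)/2) + (4*(m+1)*ee m - 20*nn m)*GG m)/(4*cc) := by
    field_simp; linear_combination -2*hB
  unfold hp Hf
  rw [hN]
  simp only [Pi.mul_apply, Pi.pow_apply]
  push_cast
  generalize gpm m (ee m) = g1 at *
  generalize gpe m (ee m) = g2 at *
  generalize GG m = g at *
  generalize pp m = p at *
  generalize ee m = e at *
  generalize nn m = n at *
  field_simp
  ring


noncomputable def Pm (m : ℝ) : ℝ := -(200*m^3+205*m)/nn m^2 - ee m/(3*nn m)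
noncomputable def Qm (m : ℝ) : ℝ := RR m/nn m^2
noncomputable def Lm (m : ℝ) : ℝ := Real.log (nn m) + (1/3)*Real.log (pp m)

lemma Lm_hasDerivAt (m : ℝ) : HasDerivAt Lm (-Pm m) m := by
  have hn := nn_pos m
  have hp := pp_pos m
  refine (((nn_hasDerivAt m).log hn.ne').add (((pp_hasDerivAt m).log hp.ne').const_mul (1/3))).congr_deriv ?_
  unfold Pm
  field_simp
  ring

noncomputable def Kf (k : ℝ → ℝ) (m : ℝ) : ℝ := pw (-(1/3)) (m+1) * k (Hf m)
noncomputable def Kf' (k k' : ℝ → ℝ) (m : ℝ) : ℝ := pw (-(1/3)) (m+1) * ((-(1/3))/(m+1) * k (Hf m) + k' (Hf m) * hp m)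

lemma H_sq (m : ℝ) (h : m + 1 ≠ 0) : Hf m^2 - 1 = pp m^2 * GG m^3/(cc^2*(m+1)^10) := by
  have hcc : cc ≠ 0 := by unfold cc; norm_num
  rw [← id_D m]
  unfold Hf
  field_simp

lemma K_sol {J : Set ℝ} {k k' : ℝ → ℝ} (hk : Sol J PG QG k k') :
    Sol {m | m ≠ -1 ∧ Hf m ∈ J ∧ Hf m^2 ≠ 1} Pm Qm (Kf k) (Kf' k k') := by
  rintro m ⟨h1, hJ, h2⟩
  have h : m + 1 ≠ 0 := by intro h; apply h1; linarith
  have h3 : Hf m^2 - 1 ≠ 0 := sub_ne_zero.2 h2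
  have hcc : cc ≠ 0 := by unfold cc; norm_num
  have hsq := H_sq m h
  have hn := nn_pos m
  have hpp := pp_pos m
  have hG : GG m ≠ 0 := by
    intro h0; rw [h0] at hsq; apply h3; rw [hsq]; ring
  have dH := Hf_hasDerivAt h
  have dhp := hp_hasDerivAt h
  obtain ⟨a, b⟩ := hk _ hJ
  have d0 := a.comp m dH
  have d1 := b.comp m dH
  have dm : HasDerivAt (fun m : ℝ => m + 1) 1 m := (hasDerivAt_id m).add_const 1
  have dp := (pw_hasDerivAt (-(1/3)) h).comp m dm
  have di : HasDerivAt (fun m : ℝ => (-(1/3))/(m+1)) ((1/3)/(m+1)^2) m := by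
    refine ((hasDerivAt_const m (-(1/3):ℝ)).div dm h).congr_deriv ?_
    field_simp
    ring
  refine ⟨(dp.mul d0).congr_deriv ?_, (dp.mul ((di.mul d0).add (d1.mul dhp))).congr_deriv ?_⟩
  · unfold Kf'
    simp only [Function.comp_apply]
    ring
  · unfold Pm Qm Kf Kf'
    simp only [Function.comp_apply, Pi.mul_apply, Pi.add_apply]
    have hA : hp m^2 = (Hf m^2-1) * (GG m/((m+1)^2*nn m^2)) := by
      rw [hsq]; unfold hp; field_simp
    have hPG : PG (Hf m) * hp m^2 = -(4/3)*Hf m * (GG m/((m+1)^2*nn m^2)) := by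
      rw [hA]; unfold PG; field_simp
    have hQG : QG (Hf m) * hp m^2 = -(4/225) * (GG m/((m+1)^2*nn m^2)) := by
      rw [hA]; unfold QG; field_simp
    have hGd := GG_def m
    have hR : RR m/nn m^2 = 4/(9*(m+1)^2) - (4/225) * (GG m/((m+1)^2*nn m^2)) - (200*m^3+205*m)/(3*(m+1)*nn m^2) - ee m/(9*(m+1)*nn m) := by
      rw [hGd]; field_simp; ring
    rw [hR]
    generalize PG (Hf m) = P at *
    generalize QG (Hf m) = Q at *
    generalize k (Hf m) = K at *
    generalize k' (Hf m) = K' at *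
    generalize pw (-(1/3)) (m+1) = W at *
    generalize hg : GG m/((m+1)^2*nn m^2) = g at *
    rw [show (4/3)*Hf m * GG m/((m+1)^2*nn m^2) = (4/3)*Hf m*g by rw [← hg]; ring]
    generalize hp m = η at *
    generalize Hf m = H at *
    generalize nn m = n at *
    generalize ee m = e at *
    clear hGd hR dm di dp d0 d1 hA hsq a b dH dhp hg
    generalize m + 1 = M at *
    linear_combination W*K'*hPG + W*K*hQG

lemma nn_even (m : ℝ) : nn (-m) = nn m := by unfold nn; congr 1; ring
lemma ee_odd (m : ℝ) : ee (-m) = -ee m := by unfold ee; rw [nn_even]; ring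
lemma RR_even (m : ℝ) : RR (-m) = RR m := by unfold RR; rw [nn_even]; ring
lemma Pm_odd (m : ℝ) : Pm (-m) = -Pm m := by unfold Pm; rw [nn_even, ee_odd]; ring
lemma Qm_even (m : ℝ) : Qm (-m) = Qm m := by unfold Qm; rw [nn_even, RR_even]

lemma Sol_refl {S : Set ℝ} {K K' : ℝ → ℝ} (h : Sol S Pm Qm K K') :
    Sol {m | -m ∈ S} Pm Qm (fun m => K (-m)) (fun m => -K' (-m)) := by
  intro m hm
  obtain ⟨a, b⟩ := h _ hm
  have d0 := a.comp m (hasDerivAt_neg m)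
  have d1 := (b.comp m (hasDerivAt_neg m)).neg
  refine ⟨d0.congr_deriv (by ring), d1.congr_deriv ?_⟩
  rw [Pm_odd, Qm_even]
  ring


noncomputable def hatH (h : ℝ) : ℝ := ((1331-1920*h+3310*h^2-3310*h^3+1920*h^4-1331*h^5) - (125*h^3-30*h^2-30*h+125) * nn h)/(81*(h+1)^5)

lemma nn_inv {h : ℝ} (h0 : h ≠ 0) : nn (1/h) = nn h/h^2 := by
  unfold nn
  rw [show 100*(1/h)^4+205*(1/h)^2+100 = (100*h^4+205*h^2+100)/(h^2)^2 by field_simp; ring,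
    Real.sqrt_div (by positivity), Real.sqrt_sq (by positivity)]

lemma Hf_inv {h : ℝ} (h0 : h ≠ 0) (h1 : h + 1 ≠ 0) : Hf (1/h) = hatH h := by
  unfold Hf NN hatH
  rw [nn_inv h0]
  have : 1/h + 1 = (h+1)/h := by field_simp; ring
  rw [this]
  field_simp
  ring

lemma nn_zero : nn 0 = 10 := by
  unfold nn
  rw [show (100*(0:ℝ)^4+205*0^2+100) = 10^2 by norm_num, Real.sqrt_sq (by norm_num)]

lemma hatH_zero : hatH 0 = 1 := by
  unfold hatH; rw [nn_zero]; norm_num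

lemma hatH_deriv : HasDerivAt hatH (-25) 0 := by
  have h0 := poly5 1331 (-1920) 3310 (-3310) 1920 (-1331) 0
  have h1 := poly5 125 (-30) (-30) 125 0 0 0
  have d := ((h0.sub (h1.mul (nn_hasDerivAt 0))).div ((mp1_pow 5 0).const_mul 81) (by norm_num))
  refine (d.congr_of_eventuallyEq (Eventually.of_forall (fun m => ?_))).congr_deriv ?_
  · unfold hatH
    simp only [Pi.sub_apply, Pi.mul_apply, Pi.div_apply]
    congr 1
    ring
  · simp only [Pi.sub_apply, Pi.mul_apply, nn_zero]
    norm_num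

/-- (1 - hatH h)/2 / h → 25/2 -/
lemma xi_slope : Tendsto (fun h : ℝ => ((1 - hatH h)/2)/h) (𝓝[≠] 0) (𝓝 (25/2)) := by
  have := (hasDerivAt_iff_tendsto_slope.1 hatH_deriv).const_mul (-(1/2))
  norm_num at this
  refine this.congr (fun h => ?_)
  rw [slope_def_field, hatH_zero]
  ring

lemma hatH_cont : Tendsto hatH (𝓝 0) (𝓝 1) := by
  have h : Tendsto hatH (𝓝 0) (𝓝 (hatH 0)) := hatH_deriv.continuousAt
  rwa [hatH_zero] at h

/-- eventually for small positive h: bounds on `hatH h`, `hatH (-h)`. -/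
lemma hat_ev : ∃ d, 0 < d ∧ d < 1 ∧ ∀ h, 0 < h → h < d → (0 < hatH h ∧ hatH h < 1) ∧ (1 < hatH (-h) ∧ hatH (-h) < 3) := by
  have e1 := xi_slope.eventually (lt_mem_nhds (show (0:ℝ) < 25/2 by norm_num))
  rw [eventually_nhdsWithin_iff] at e1
  have e2 := hatH_cont.eventually (Ioo_mem_nhds (show (0:ℝ) < 1 by norm_num) (show (1:ℝ) < 3 by norm_num))
  obtain ⟨d, hd, hh⟩ := Metric.eventually_nhds_iff.1 (e1.and e2)
  refine ⟨min d (1/2), by positivity, by have := min_le_right d (1/2); linarith, fun h h0 h1 => ?_⟩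
  have hlt : h < d := lt_of_lt_of_le h1 (min_le_left _ _)
  obtain ⟨a1, a2⟩ := hh (y := h) (by simpa [abs_of_pos h0] using hlt)
  obtain ⟨b1, b2⟩ := hh (y := -h) (by simpa [abs_of_pos h0] using hlt)
  have a3 := a1 (by simp; exact h0.ne')
  have b3 := b1 (by simp; exact h0.ne')
  refine ⟨⟨a2.1, ?_⟩, ?_, b2.2⟩
  · have := (div_pos_iff_of_pos_right h0).1 a3
    linarith
  · rw [div_neg, ← neg_div] at b3
    have := (div_pos_iff_of_pos_right h0).1 b3
    linarith

lemma large_ev : ∃ M, 1 < M ∧ ∀ m, M < m → (0 < Hf m ∧ Hf m < 1) ∧ (1 < Hf (-m) ∧ Hf (-m) < 3) := by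
  obtain ⟨d, h0, h1, hh⟩ := hat_ev
  refine ⟨1/d, by rw [lt_div_iff₀ h0]; linarith, fun m hm => ?_⟩
  have hm0 : 0 < m := lt_trans (by positivity) hm
  have hmd : 1/m < d := by rwa [div_lt_comm₀ hm0 h0]
  have hp : 0 < 1/m := by positivity
  have := hh (1/m) hp hmd
  rw [← Hf_inv hp.ne' (by positivity), ← Hf_inv (by linarith) (by linarith)] at this
  simpa [div_neg] using this

lemma hp_nonneg (m : ℝ) : 0 ≤ hp m := by
  have := pp_pos m
  have := nn_pos m
  unfold hp cc
  positivity

lemma Hf_mono_right : MonotoneOn Hf (Set.Ioi (-1)) := by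
  apply monotoneOn_of_deriv_nonneg (convex_Ioi _)
  · intro x hx
    have : -1 < x := hx
    exact (Hf_hasDerivAt (by linarith)).continuousAt.continuousWithinAt
  · intro x hx
    rw [interior_Ioi] at hx
    have : -1 < x := hx
    exact (Hf_hasDerivAt (by linarith)).differentiableAt.differentiableWithinAt
  · intro x hx
    rw [interior_Ioi] at hx
    have : -1 < x := hx
    rw [(Hf_hasDerivAt (by linarith)).deriv]
    exact hp_nonneg x

lemma Hf_mono_left : MonotoneOn Hf (Set.Iio (-1)) := by
  apply monotoneOn_of_deriv_nonneg (convex_Iio _)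
  · intro x hx
    have : x < -1 := hx
    exact (Hf_hasDerivAt (by linarith)).continuousAt.continuousWithinAt
  · intro x hx
    rw [interior_Iio] at hx
    have : x < -1 := hx
    exact (Hf_hasDerivAt (by linarith)).differentiableAt.differentiableWithinAt
  · intro x hx
    rw [interior_Iio] at hx
    have : x < -1 := hx
    rw [(Hf_hasDerivAt (by linarith)).deriv]
    exact hp_nonneg x

lemma Hf_lt_one {m : ℝ} (h : -1 < m) : Hf m < 1 := by
  obtain ⟨M, hM, hh⟩ := large_ev
  have h1 := (hh (max (M+1) m) (lt_of_lt_of_le (by linarith) (le_max_left _ _))).1.2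
  have h2 := Hf_mono_right (show m ∈ Set.Ioi (-1:ℝ) from h) (show max (M+1) m ∈ Set.Ioi (-1:ℝ) from lt_of_lt_of_le h (le_max_right _ _)) (le_max_right _ _)
  linarith

lemma Hf_gt_one {m : ℝ} (h : m < -1) : 1 < Hf m := by
  obtain ⟨M, hM, hh⟩ := large_ev
  have h1 := (hh (max (M+1) (-m)) (lt_of_lt_of_le (by linarith) (le_max_left _ _))).2.1
  have h3 : -max (M+1) (-m) ≤ m := by have := le_max_right (M+1) (-m); linarith
  have h2 := Hf_mono_left (show -max (M+1) (-m) ∈ Set.Iio (-1:ℝ) from lt_of_le_of_lt h3 h) (show m ∈ Set.Iio (-1:ℝ) from h) h3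
  linarith

lemma nn_one : nn 1 = 9*Real.sqrt 5 := by
  unfold nn
  rw [show (100*(1:ℝ)^4+205*1^2+100) = 9^2*5 by norm_num, Real.sqrt_mul (by norm_num), Real.sqrt_sq (by norm_num)]

lemma NN_one : NN 1 = -(190*Real.sqrt 5/9) := by
  unfold NN; rw [nn_one]; ring

lemma NN_neg_one : NN (-1) = -162 := by
  unfold NN; rw [nn_even, nn_one]; ring

lemma Hf_one : -3 < Hf 1 ∧ Hf 1 < -1 := by
  have h5 : Real.sqrt 5^2 = 5 := Real.sq_sqrt (by norm_num)
  have h0 : 0 ≤ Real.sqrt 5 := Real.sqrt_nonneg _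
  unfold Hf
  rw [NN_one]
  norm_num
  constructor
  · nlinarith
  · nlinarith

lemma geom : ∃ ε, 0 < ε ∧ ε < 1 ∧ (∀ m, -1 < m → m < 1 + ε → Hf m < -1) ∧ (∀ m, 1 - ε < m → -3 < Hf m) := by
  have hc : ContinuousAt Hf 1 := (Hf_hasDerivAt (by norm_num)).continuousAt
  obtain ⟨h3, h1⟩ := Hf_one
  obtain ⟨d, hd, hh⟩ := Metric.eventually_nhds_iff.1 (hc.eventually (Ioo_mem_nhds h3 h1))
  have hm := min_le_right d (1:ℝ)
  have hm' := min_le_left d (1:ℝ)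
  have hm0 : 0 < min d 1 := by positivity
  refine ⟨min d 1/2, by positivity, by linarith, ?_, ?_⟩
  · intro m h1 h2
    have := (hh (y := 1 + min d 1/2) (by
      rw [Real.dist_eq, abs_of_pos (by linarith)]; linarith)).2
    have := Hf_mono_right (show m ∈ Set.Ioi (-1:ℝ) from h1) (show 1 + min d 1/2 ∈ Set.Ioi (-1:ℝ) from by rw [Set.mem_Ioi]; linarith) h2.le
    linarith
  · intro m h1
    have := (hh (y := 1 - min d 1/2) (by
      rw [Real.dist_eq, abs_of_neg (by linarith)]; linarith)).1
    have := Hf_mono_right (show 1 - min d 1/2 ∈ Set.Ioi (-1:ℝ) from by rw [Set.mem_Ioi]; linarith) (show m ∈ Set.Ioi (-1:ℝ) from by rw [Set.mem_Ioi]; linarith) h1.le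
    linarith


noncomputable def phf (h : ℝ) : ℝ := pw (-(1/3)) (1+h) * k1 (hatH h)
noncomputable def psf (h : ℝ) : ℝ := pw (-(1/3)) (1+h) * k2 (hatH h)

lemma Kf_inv (k : ℝ → ℝ) {h : ℝ} (h0 : h ≠ 0) (h1 : h + 1 ≠ 0) :
    Kf k (1/h) = pw (1/3) h * (pw (-(1/3)) (1+h) * k (hatH h)) := by
  unfold Kf
  rw [Hf_inv h0 h1, show 1/h + 1 = (1+h)/h by field_simp, pw_div _ (by rwa [add_comm]) h0,
    pw_neg_exp (1/3) h]
  have := pw_pos (1/3) h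
  field_simp

lemma pw_at_one (s : ℝ) : pw s 1 = 1 := by simp [pw]

lemma xi0 : (1 - hatH 0)/2 = 0 := by rw [hatH_zero]; norm_num

lemma xih_deriv : HasDerivAt (fun h => (1 - hatH h)/2) (25/2) 0 :=
  ((hatH_deriv.const_sub 1).div_const 2).congr_deriv (by norm_num)

lemma pref_deriv (s : ℝ) : HasDerivAt (fun h : ℝ => pw s (1+h)) s 0 := by
  have h1 : HasDerivAt (fun h : ℝ => 1 + h) 1 0 := (hasDerivAt_id (0:ℝ)).const_add 1
  have h2 : HasDerivAt (pw s) (pw s 1 * (s/1)) (1+0) := by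
    rw [add_zero]; exact pw_hasDerivAt s one_ne_zero
  refine (h2.comp (0:ℝ) h1).congr_deriv ?_
  rw [pw_at_one]; ring

lemma phf_deriv : ∃ d, HasDerivAt phf d 0 := by
  have hF := F_hasDerivAt (a := 1/15) (b := 4/15) (c := 2/3) (by norm_num) (by norm_num) (by norm_num) (x := 0) (by simp)
  rw [← xi0] at hF
  exact ⟨_, (pref_deriv (-(1/3))).mul (hF.comp (0:ℝ) xih_deriv)⟩

lemma phf_zero : phf 0 = 1 := by
  unfold phf k1
  rw [xi0, F_zero, add_zero, pw_at_one]; norm_num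

lemma xih_ne : Tendsto (fun h => (1 - hatH h)/2) (𝓝[≠] 0) (𝓝 0) := by
  have : Tendsto (fun h => (1 - hatH h)/2) (𝓝 0) (𝓝 ((1 - hatH 0)/2)) := xih_deriv.continuousAt
  rw [xi0] at this
  exact this.mono_left nhdsWithin_le_nhds

lemma psf_div : Tendsto (fun h => psf h / pw (1/3) h) (𝓝[≠] 0) (𝓝 (pw (1/3) (25/2))) := by
  have t1 : Tendsto (fun h : ℝ => pw (-(1/3)) (1+h)) (𝓝[≠] 0) (𝓝 1) := by
    have : Tendsto (fun h : ℝ => pw (-(1/3)) (1+h)) (𝓝 0) (𝓝 (pw (-(1/3)) (1+0))) := (pref_deriv (-(1/3))).continuousAt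
    rw [add_zero, pw_at_one] at this
    exact this.mono_left nhdsWithin_le_nhds
  have t2 : Tendsto (fun h => pw (1/3) (((1 - hatH h)/2)/h)) (𝓝[≠] 0) (𝓝 (pw (1/3) (25/2))) :=
    ((pw_hasDerivAt (1/3) (show (25/2:ℝ) ≠ 0 by norm_num)).continuousAt.tendsto).comp xi_slope
  have t3 := (F_cont0 (a := 2/5) (b := 3/5) (c := 4/3) (by norm_num) (by norm_num) (by norm_num)).comp xih_ne
  have t := (t1.mul t2).mul t3
  rw [one_mul, mul_one] at t
  refine t.congr' ?_
  have e1 := xi_slope.eventually (lt_mem_nhds (show (0:ℝ) < 25/2 by norm_num))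
  filter_upwards [e1, self_mem_nhdsWithin] with h hh h0
  have h0 : h ≠ 0 := h0
  have hx : (1 - hatH h)/2 ≠ 0 := by
    intro h1; rw [h1] at hh; simp at hh
  rw [pw_div _ hx h0]
  unfold psf k2
  simp only [Function.comp_apply]
  ring

lemma psf_tendsto : Tendsto psf (𝓝[≠] 0) (𝓝 0) := by
  have := psf_div.mul (pw_tendsto_zero (s := 1/3) (by norm_num))
  rw [mul_zero] at this
  refine this.congr (fun h => ?_)
  have := pw_pos (1/3) h
  field_simp

lemma phf_tendsto : Tendsto phf (𝓝[≠] 0) (𝓝 1) := by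
  obtain ⟨d, hd⟩ := phf_deriv
  have : Tendsto phf (𝓝 0) (𝓝 (phf 0)) := hd.continuousAt
  rw [phf_zero] at this
  exact this.mono_left nhdsWithin_le_nhds

lemma gt_le_ne : 𝓝[>] (0:ℝ) ≤ 𝓝[≠] 0 := nhdsWithin_mono _ (fun x hx => ne_of_gt hx)

lemma neg_gt : Tendsto (fun h : ℝ => -h) (𝓝[>] (0:ℝ)) (𝓝[≠] 0) := by
  rw [tendsto_nhdsWithin_iff]
  constructor
  · have : Tendsto (fun h : ℝ => -h) (𝓝 0) (𝓝 (-0)) := continuous_neg.continuousAt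
    rw [neg_zero] at this
    exact this.mono_left nhdsWithin_le_nhds
  · filter_upwards [self_mem_nhdsWithin] with x hx h
    have hx : 0 < x := hx
    simp at h
    exact hx.ne' h

lemma phf_diff : Tendsto (fun h => (phf (-h) - phf h)/pw (1/3) h) (𝓝[>] 0) (𝓝 0) := by
  obtain ⟨d, hd⟩ := phf_deriv
  have s := hasDerivAt_iff_tendsto_slope.1 hd
  have s1 := s.mono_left gt_le_ne
  have s2 := s.comp neg_gt
  have t := ((s2.add s1).neg).mul ((pw_tendsto_zero (s := 2/3) (by norm_num)).mono_left gt_le_ne)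
  rw [mul_zero] at t
  refine t.congr' ?_
  filter_upwards [self_mem_nhdsWithin] with h h0
  have h0 : 0 < h := h0
  have e : pw (1/3) h * pw (2/3) h = h := by
    rw [← pw_add, show (1/3+2/3:ℝ) = 1 by norm_num, pw_one h0.ne', abs_of_pos h0]
  have := pw_pos (1/3) h
  simp only [Function.comp_apply, slope_def_field]
  rw [eq_div_iff this.ne']
  have e2 : pw (2/3) h * pw (1/3) h = h := by rw [mul_comm]; exact e
  rw [mul_assoc, e2, sub_zero, sub_zero, div_neg]
  field_simp
  ring

lemma plem : ∃ M, 1 < M ∧ ∀ m, M < m → Kf k1 (-m) = Kf k1 m ∧ Kf k2 (-m) = Kf k2 m := by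
  obtain ⟨M, hM, hh⟩ := large_ev
  have sub : Set.Ioi M ⊆ {m | m ≠ -1 ∧ Hf m ∈ {H | -1 < H ∧ H < 3 ∧ H ≠ 1} ∧ Hf m^2 ≠ 1} := by
    intro m hm
    have hm' : M < m := hm
    obtain ⟨⟨a, b⟩, _⟩ := hh m hm
    refine ⟨by linarith, ⟨by linarith, by linarith, b.ne⟩, ?_⟩
    nlinarith
  have sub' : Set.Ioi M ⊆ {m | -m ∈ {m | m ≠ -1 ∧ Hf m ∈ {H | -1 < H ∧ H < 3 ∧ H ≠ 1} ∧ Hf m^2 ≠ 1}} := by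
    intro m hm
    have hm' : M < m := hm
    obtain ⟨_, ⟨a, b⟩⟩ := hh m hm
    refine ⟨by intro h; linarith, ⟨by linarith, by linarith, a.ne'⟩, ?_⟩
    nlinarith
  have s1 := (K_sol k1_sol).mono sub
  have s2 := (K_sol k2_sol).mono sub
  have r1 := (Sol_refl (K_sol k1_sol)).mono sub'
  have r2 := (Sol_refl (K_sol k2_sol)).mono sub'
  have hM0 : 0 < 1/M := by positivity
  have hev : ∀ᶠ h in 𝓝[>] (0:ℝ), h ∈ Set.Ioo (0:ℝ) (1/M) := Ioo_mem_nhdsGT hM0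
  have big : ∀ h ∈ Set.Ioo (0:ℝ) (1/M), M < 1/h := by
    intro h hh
    rw [lt_div_comm₀ (by linarith) hh.1]; exact hh.2
  have small : ∀ h ∈ Set.Ioo (0:ℝ) (1/M), h < 1 := by
    intro h hh
    have : 1/M < 1 := by rw [div_lt_one (by linarith)]; exact hM
    linarith [hh.2]
  have kp : ∀ (k : ℝ → ℝ), ∀ h ∈ Set.Ioo (0:ℝ) (1/M), Kf k (1/h) = pw (1/3) h * (pw (-(1/3)) (1+h) * k (hatH h)) ∧ Kf k (-(1/h)) = pw (1/3) h * (pw (-(1/3)) (1+(-h)) * k (hatH (-h))) := by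
    intro k h hi
    have := hi.1
    have := small h hi
    refine ⟨Kf_inv k (by linarith) (by linarith), ?_⟩
    rw [← div_neg, Kf_inv k (by linarith) (by linarith), pw_neg]
  have h0 : ∀ m ∈ Set.Ioi M, Kf k1 m ≠ 0 := by
    intro m hm
    obtain ⟨⟨a, b⟩, _⟩ := hh m hm
    have := F_ge_one (a := 1/15) (b := 4/15) (c := 2/3) (by norm_num) (by norm_num) (by norm_num) (x := (1-Hf m)/2) (by linarith) (by linarith)
    unfold Kf k1
    have := pw_pos (-(1/3)) (m+1)
    positivity
  have conv : ∀ (K : ℝ → ℝ) (A B : ℝ), (∀ m ∈ Set.Ioi M, K m = A * Kf k1 m + B * Kf k2 m) →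
      ∀ h ∈ Set.Ioo (0:ℝ) (1/M), K (1/h) = pw (1/3) h * (A * phf h + B * psf h) := by
    intro K A B hK h hi
    rw [hK _ (big h hi), (kp k1 h hi).1, (kp k2 h hi).1]
    unfold phf psf
    ring
  have tph := phf_tendsto.mono_left gt_le_ne
  have tps := psf_tendsto.mono_left gt_le_ne
  have tpd := psf_div.mono_left gt_le_ne
  have npos := pw_pos (1/3) (25/2)
  have hn : ¬ ∃ k, ∀ m ∈ Set.Ioi M, Kf k2 m = k * Kf k1 m := by
    rintro ⟨k, hk⟩
    have e : ∀ᶠ h in 𝓝[>] (0:ℝ), k * phf h = psf h := by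
      filter_upwards [hev] with h hi
      have := hk _ (big h hi)
      rw [(kp k1 h hi).1, (kp k2 h hi).1] at this
      apply mul_left_cancel₀ (pw_pos (1/3) h).ne'
      unfold phf psf
      linear_combination -this
    have hk0 := tendsto_nhds_unique ((tph.const_mul k).congr' e) tps
    rw [mul_one] at hk0
    have z : Tendsto (fun h => psf h / pw (1/3) h) (𝓝[>] 0) (𝓝 0) := by
      refine tendsto_const_nhds.congr' ?_
      filter_upwards [e] with h he
      rw [← he, hk0]; simp
    exact npos.ne' (tendsto_nhds_unique tpd z)
  have hL : ∀ m ∈ Set.Ioi M, HasDerivAt Lm (-Pm m) m := fun m _ => Lm_hasDerivAt m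
  obtain ⟨A, B, hAB⟩ := wr_span isOpen_Ioi isPreconnected_Ioi hL s1 s2 r1 h0 hn
  obtain ⟨C, D, hCD⟩ := wr_span isOpen_Ioi isPreconnected_Ioi hL s1 s2 r2 h0 hn
  have e1 : ∀ᶠ h in 𝓝[>] (0:ℝ), A * phf h + B * psf h = phf (-h) := by
    filter_upwards [hev] with h hi
    have := conv _ A B hAB h hi
    simp only [(kp k1 h hi).2] at this
    exact (mul_left_cancel₀ (pw_pos (1/3) h).ne' this).symm
  have e2 : ∀ᶠ h in 𝓝[>] (0:ℝ), C * phf h + D * psf h = psf (-h) := by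
    filter_upwards [hev] with h hi
    have := conv _ C D hCD h hi
    simp only [(kp k2 h hi).2] at this
    exact (mul_left_cancel₀ (pw_pos (1/3) h).ne' this).symm
  have hA := tendsto_nhds_unique (((tph.const_mul A).add (tps.const_mul B)).congr' e1) (phf_tendsto.comp neg_gt)
  have hC := tendsto_nhds_unique (((tph.const_mul C).add (tps.const_mul D)).congr' e2) (psf_tendsto.comp neg_gt)
  simp at hA hC
  subst hA hC
  have hB := tendsto_nhds_unique ((tpd.const_mul B).congr' (by
    filter_upwards [e1] with h he
    rw [← he]
    show _ = (1 * phf h + B * psf h - phf h)/pw (1/3) h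
    ring)) phf_diff
  have hD := tendsto_nhds_unique ((tpd.const_mul D).congr' (by
    filter_upwards [e2] with h he
    have := pw_neg (1/3) h
    show _ = psf (-h)/pw (1/3) (-h)
    rw [← he, this]
    ring)) (psf_div.comp neg_gt)
  have hB : B = 0 := by
    rcases mul_eq_zero.1 hB with h | h
    · exact h
    · exact absurd h npos.ne'
  have hD : D = 1 := by
    apply mul_right_cancel₀ npos.ne'
    linarith
  refine ⟨M, hM, fun m hm => ⟨?_, ?_⟩⟩
  · have := hAB m hm
    rw [hB] at this
    simpa using this
  · have := hCD m hm
    rw [hD] at this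
    simpa using this


lemma nn_an (m : ℝ) : AnalyticAt ℝ nn m := by
  have h1 : AnalyticAt ℝ (fun m : ℝ => 100*m^4+205*m^2+100) m := by fun_prop
  have h2 := (pw_analyticAt (1/2) (x := 100*m^4+205*m^2+100) (by positivity)).comp (f := fun m : ℝ => 100*m^4+205*m^2+100) h1
  have e : (pw (1/2) ∘ fun m : ℝ => 100*m^4+205*m^2+100) = nn := by
    funext m
    simp only [Function.comp_apply, nn]
    rw [pw_rpow _ (by positivity), Real.sqrt_eq_rpow]
  rwa [e] at h2

lemma ee_an (m : ℝ) : AnalyticAt ℝ ee m := by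
  have h := nn_an m
  have hq := qq_pos m
  have h1 : AnalyticAt ℝ (fun m : ℝ => 5*m) m := by fun_prop
  have h2 : AnalyticAt ℝ (fun m : ℝ => nn m + 10*m^2+10) m := by fun_prop
  exact h1.div h2 hq.ne'

lemma pp_an (m : ℝ) : AnalyticAt ℝ pp m := by
  have h := ee_an m
  show AnalyticAt ℝ (fun m => m * ee m + 20) m
  fun_prop

lemma GG_an (m : ℝ) : AnalyticAt ℝ GG m := by
  have h := ee_an m
  show AnalyticAt ℝ (fun m => gp m (ee m)) m
  unfold gp
  fun_prop

lemma NN_an (m : ℝ) : AnalyticAt ℝ NN m := by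
  have h := nn_an m
  show AnalyticAt ℝ (fun m => ((1331*m^5-1920*m^4+3310*m^3-3310*m^2+1920*m-1331) - (125*m^3-30*m^2-30*m+125) * nn m)/81) m
  fun_prop (disch := norm_num)

lemma Hf_an {m : ℝ} (h : m + 1 ≠ 0) : AnalyticAt ℝ Hf m := by
  have h1 : AnalyticAt ℝ (fun m : ℝ => (m+1)^5) m := by fun_prop
  exact (NN_an m).div h1 (pow_ne_zero _ h)

noncomputable def y1 (m : ℝ) : ℝ := pw (-(1/15)) (-NN m) * twoFone (1/30) (8/15) (9/10) ((m+1)^10/NN m^2)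
noncomputable def y2 (m : ℝ) : ℝ := (m+1) * pw (-(4/15)) (-NN m) * twoFone (2/15) (19/30) (11/10) ((m+1)^10/NN m^2)

lemma NN_eq {m : ℝ} (h : m + 1 ≠ 0) : NN m = Hf m * (m+1)^5 := by
  unfold Hf; field_simp

lemma t_eq {m : ℝ} (h : m + 1 ≠ 0) (h2 : Hf m ≠ 0) : (m+1)^10/NN m^2 = 1/Hf m^2 := by
  rw [NN_eq h]; field_simp

lemma y1_eq {m : ℝ} (h : m + 1 ≠ 0) (h2 : Hf m ≠ 0) : y1 m = pw (-(1/3)) (m+1) * Y1 (Hf m) := by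
  unfold y1 Y1
  rw [t_eq h h2, pw_neg, NN_eq h, pw_mul _ h2 (pow_ne_zero _ h), pw_pow,
    show (-(1/15)*((5:ℕ):ℝ)) = -(1/3) by norm_num]
  ring

lemma y2_eq {m : ℝ} (h : m + 1 ≠ 0) (h2 : Hf m ≠ 0) : |m+1| * y2 m = (m+1) * (pw (-(1/3)) (m+1) * Y2 (Hf m)) := by
  unfold y2 Y2
  rw [t_eq h h2, pw_neg, NN_eq h, pw_mul _ h2 (pow_ne_zero _ h), pw_pow,
    show (-(4/15)*((5:ℕ):ℝ)) = -(1/3)+(-1) by norm_num, pw_add, pw_neg_exp 1, pw_one h]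
  have := abs_pos.2 h
  field_simp

lemma y2_pos' {m : ℝ} (h : 0 < m + 1) (h2 : Hf m ≠ 0) : y2 m = pw (-(1/3)) (m+1) * Y2 (Hf m) := by
  have := y2_eq h.ne' h2
  rw [abs_of_pos h] at this
  exact mul_left_cancel₀ h.ne' this

lemma y2_neg' {m : ℝ} (h : m + 1 < 0) (h2 : Hf m ≠ 0) : y2 m = -(pw (-(1/3)) (m+1) * Y2 (Hf m)) := by
  have := y2_eq h.ne h2
  rw [abs_of_neg h] at this
  apply mul_left_cancel₀ h.ne
  linarith

lemma Y1_even (H : ℝ) : Y1 (-H) = Y1 H := by unfold Y1; rw [pw_neg, neg_sq]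
lemma Y2_even (H : ℝ) : Y2 (-H) = Y2 H := by unfold Y2; rw [pw_neg, neg_sq]

lemma t_abs {ε : ℝ} (hε : ∀ m, -1 < m → m < 1 + ε → Hf m < -1) {m : ℝ} (hm : m < 1 + ε) :
    NN m < 0 ∧ |(m+1)^10/NN m^2| < 1 := by
  rcases lt_trichotomy m (-1) with h | h | h
  · have h1 := Hf_gt_one h
    have hn : m + 1 < 0 := by linarith
    have h5 : (m+1)^5 < 0 := Odd.pow_neg (by decide) hn
    refine ⟨?_, ?_⟩
    · rw [NN_eq hn.ne]; exact mul_neg_of_pos_of_neg (by linarith) h5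
    · rw [t_eq hn.ne (by linarith)]; exact xH_abs h1
  · subst h
    rw [NN_neg_one]; norm_num
  · have h1 := hε m h hm
    have hn : 0 < m + 1 := by linarith
    refine ⟨?_, ?_⟩
    · rw [NN_eq hn.ne']; exact mul_neg_of_neg_of_pos (by linarith) (by positivity)
    · rw [t_eq hn.ne' (by linarith), ← neg_sq]; exact xH_abs (by linarith)

lemma y_an {ε : ℝ} (hε : ∀ m, -1 < m → m < 1 + ε → Hf m < -1) {m : ℝ} (hm : m < 1 + ε) :
    AnalyticAt ℝ y1 m ∧ AnalyticAt ℝ y2 m := by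
  obtain ⟨h1, h2⟩ := t_abs hε hm
  have hN := NN_an m
  have hp (s : ℝ) : AnalyticAt ℝ (fun m => pw s (-NN m)) m :=
    (pw_analyticAt s (x := -NN m) (by linarith)).comp (f := fun m => -NN m) hN.neg
  have ht : AnalyticAt ℝ (fun m => (m+1)^10/NN m^2) m := by
    have a : AnalyticAt ℝ (fun m : ℝ => (m+1)^10) m := by fun_prop
    exact a.div (hN.pow 2) (pow_ne_zero _ h1.ne)
  have hF {a b c : ℝ} (ha : 0 < a) (hb : 0 < b) (hc : 0 < c) : AnalyticAt ℝ (fun m => twoFone a b c ((m+1)^10/NN m^2)) m :=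
    (F_analyticAt ha hb hc h2).comp (f := fun m => (m+1)^10/NN m^2) ht
  have hl : AnalyticAt ℝ (fun m : ℝ => m+1) m := by fun_prop
  exact ⟨(hp _).mul (hF (by norm_num) (by norm_num) (by norm_num)),
    (hl.mul (hp _)).mul (hF (by norm_num) (by norm_num) (by norm_num))⟩

lemma z_an {ε : ℝ} (hε : ∀ m, -1 < m → m < 1 + ε → Hf m < -1) {m : ℝ} (hm : -1 - ε < m) :
    AnalyticAt ℝ (fun m => y1 (-m)) m ∧ AnalyticAt ℝ (fun m => y2 (-m)) m := by
  obtain ⟨h1, h2⟩ := y_an hε (m := -m) (by linarith)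
  have hl : AnalyticAt ℝ (fun m : ℝ => -m) m := by fun_prop
  exact ⟨h1.comp (f := fun m => -m) hl, h2.comp (f := fun m => -m) hl⟩

noncomputable def chi (m : ℝ) : ℝ := -GG m * pw (1/3) (pp m^2/(2*cc^2*(m+1)^10*(1-Hf m)))
noncomputable def q1 (m : ℝ) : ℝ := pw (-(1/3)) (m+1) * twoFone (1/15) (4/15) (2/3) ((1+Hf m)/2)
noncomputable def q2 (m : ℝ) : ℝ := pw (-(1/3)) (m+1) * chi m * twoFone (2/5) (3/5) (4/3) ((1+Hf m)/2)

lemma q1_eq (m : ℝ) : q1 m = pw (-(1/3)) (m+1) * k1 (-Hf m) := by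
  unfold q1 k1; rw [sub_neg_eq_add]

lemma chi_pre {m : ℝ} (h : -1 < m) (hG : GG m ≠ 0) :
    pw (1/3) ((1+Hf m)/2) = |GG m| * pw (1/3) (pp m^2/(2*cc^2*(m+1)^10*(1-Hf m))) := by
  have h1 := Hf_lt_one h
  have hn : 0 < m + 1 := by linarith
  have hcc : 0 < cc := by unfold cc; norm_num
  have hp := pp_pos m
  have h1' : 0 < 1 - Hf m := by linarith
  have hs := H_sq m hn.ne'
  have e : (1+Hf m)/2 = -(GG m^3 * (pp m^2/(2*cc^2*(m+1)^10*(1-Hf m)))) := by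
    field_simp at hs ⊢
    linear_combination (-1)*hs
  rw [e, pw_neg, pw_mul _ (pow_ne_zero _ hG) (by positivity), pw_pow,
    show (1/3*((3:ℕ):ℝ)) = 1 by norm_num, pw_one hG]

lemma GG_sgn {m : ℝ} (h : -1 < m) : (-1 < Hf m → GG m < 0) ∧ (Hf m < -1 → 0 < GG m) := by
  have h1 := Hf_lt_one h
  have hn : 0 < m + 1 := by linarith
  have hcc : 0 < cc := by unfold cc; norm_num
  have hp := pp_pos m
  have hs := H_sq m hn.ne'
  have e : GG m^3 = (Hf m^2-1) * (cc^2*(m+1)^10/pp m^2) := by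
    rw [hs]; field_simp
  have hpos : 0 < cc^2*(m+1)^10/pp m^2 := by positivity
  constructor
  · intro h2
    have : GG m^3 < 0 := by
      rw [e]; exact mul_neg_of_neg_of_pos (by nlinarith) hpos
    by_contra hc
    push Not at hc
    have := pow_nonneg hc 3
    linarith
  · intro h2
    have : 0 < GG m^3 := by
      rw [e]; exact mul_pos (by nlinarith) hpos
    by_contra hc
    push Not at hc
    have : (0:ℝ) ≤ (-GG m)^3 := pow_nonneg (by linarith) 3
    have e3 : (-GG m)^3 = -GG m^3 := by ring
    linarith

lemma q2_in {m : ℝ} (h : -1 < m) (h2 : -1 < Hf m) : q2 m = pw (-(1/3)) (m+1) * k2 (-Hf m) := by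
  have hG := (GG_sgn h).1 h2
  have := chi_pre h hG.ne
  unfold q2 k2 chi
  rw [sub_neg_eq_add, this, abs_of_neg hG]
  ring

lemma q2_out {m : ℝ} (h : -1 < m) (h2 : Hf m < -1) : q2 m = -(pw (-(1/3)) (m+1) * k2 (-Hf m)) := by
  have hG := (GG_sgn h).2 h2
  have := chi_pre h hG.ne'
  unfold q2 k2 chi
  rw [sub_neg_eq_add, this, abs_of_pos hG]
  ring

lemma q_an {m : ℝ} (h : -1 < m) (h3 : -3 < Hf m) : AnalyticAt ℝ q1 m ∧ AnalyticAt ℝ q2 m := by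
  have h1 := Hf_lt_one h
  have hn : 0 < m + 1 := by linarith
  have hcc : 0 < cc := by unfold cc; norm_num
  have hpp := pp_pos m
  have h1' : 0 < 1 - Hf m := by linarith
  have hH := Hf_an hn.ne'
  have hl : AnalyticAt ℝ (fun m : ℝ => m+1) m := by fun_prop
  have hp : AnalyticAt ℝ (fun m => pw (-(1/3)) (m+1)) m :=
    (pw_analyticAt _ hn).comp (f := fun m => m+1) hl
  have hx : AnalyticAt ℝ (fun m => (1+Hf m)/2) m := by fun_prop (disch := norm_num)
  have hF {a b c : ℝ} (ha : 0 < a) (hb : 0 < b) (hc : 0 < c) : AnalyticAt ℝ (fun m => twoFone a b c ((1+Hf m)/2)) m :=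
    (F_analyticAt ha hb hc (by rw [abs_lt]; constructor <;> linarith)).comp (f := fun m => (1+Hf m)/2) hx
  have hden : AnalyticAt ℝ (fun m => 2*cc^2*(m+1)^10*(1-Hf m)) m := by fun_prop
  have hr : AnalyticAt ℝ (fun m => pp m^2/(2*cc^2*(m+1)^10*(1-Hf m))) m :=
    ((pp_an m).pow 2).div hden (by positivity)
  have hc : AnalyticAt ℝ chi m :=
    (GG_an m).neg.mul ((pw_analyticAt (1/3) (x := pp m^2/(2*cc^2*(m+1)^10*(1-Hf m))) (by positivity)).comp
      (f := fun m => pp m^2/(2*cc^2*(m+1)^10*(1-Hf m))) hr)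
  exact ⟨hp.mul (hF (by norm_num) (by norm_num) (by norm_num)),
    (hp.mul hc).mul (hF (by norm_num) (by norm_num) (by norm_num))⟩

lemma an_ext {S : Set ℝ} (hS : IsPreconnected S) {f g : ℝ → ℝ} (hf : ∀ x ∈ S, AnalyticAt ℝ f x)
    (hg : ∀ x ∈ S, AnalyticAt ℝ g x) {x0 : ℝ} (h0 : x0 ∈ S) (he : ∀ᶠ x in 𝓝 x0, f x = g x) :
    ∀ x ∈ S, f x = g x :=
  AnalyticOnNhd.eqOn_of_preconnected_of_eventuallyEq hf hg hS h0 he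

lemma lin_ext {ε M A B C D : ℝ} (hε0 : 0 < ε) (hε1 : ε < 1) (hM : 1 < M)
    (hε : ∀ m, -1 < m → m < 1 + ε → Hf m < -1) (hε3 : ∀ m, 1 - ε < m → -3 < Hf m)
    {α β γ δ : ℝ} (h1 : ∀ H ∈ Set.Ioo (1:ℝ) 3, k1 H = α * Y1 H + β * Y2 H)
    (h2 : ∀ H ∈ Set.Ioo (1:ℝ) 3, k2 H = γ * Y1 H + δ * Y2 H)
    (hlarge : ∀ m, M < m → A * y1 (-m) - B * y2 (-m) = C * q1 m + D * q2 m) :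
    ∀ m, -1 - ε < m → m < 1 + ε → A * y1 (-m) - B * y2 (-m) =
      C * (α * y1 m + β * y2 m) - D * (γ * y1 m + δ * y2 m) := by
  have hL : ∀ m ∈ Set.Ioi (-1-ε), AnalyticAt ℝ (fun m => A * y1 (-m) - B * y2 (-m)) m := by
    intro m hm
    obtain ⟨a, b⟩ := z_an hε (m := m) hm
    exact (analyticAt_const.mul a).sub (analyticAt_const.mul b)
  have hR : ∀ m ∈ Set.Ioi (1-ε), AnalyticAt ℝ (fun m => C * q1 m + D * q2 m) m := by
    intro m hm
    have hm' : 1 - ε < m := hm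
    obtain ⟨a, b⟩ := q_an (m := m) (by linarith) (hε3 m hm)
    exact (analyticAt_const.mul a).add (analyticAt_const.mul b)
  have e1 := an_ext (isPreconnected_Ioi (a := 1-ε)) (fun m hm => hL m (by
      have : 1 - ε < m := hm
      rw [Set.mem_Ioi]; linarith)) hR (x0 := M+1) (by rw [Set.mem_Ioi]; linarith) (by
    filter_upwards [Ioi_mem_nhds (show M < M+1 by linarith)] with m hm
    exact hlarge m hm)
  have hY : ∀ m ∈ Set.Ioo (-1-ε) (1+ε), AnalyticAt ℝ (fun m => C * (α * y1 m + β * y2 m) - D * (γ * y1 m + δ * y2 m)) m := by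
    intro m hm
    obtain ⟨a, b⟩ := y_an hε (m := m) hm.2
    exact (analyticAt_const.mul ((analyticAt_const.mul a).add (analyticAt_const.mul b))).sub
      (analyticAt_const.mul ((analyticAt_const.mul a).add (analyticAt_const.mul b)))
  have e2 := an_ext (isPreconnected_Ioo (a := -1-ε) (b := 1+ε)) (fun m hm => hL m hm.1) hY (x0 := 1)
    ⟨by linarith, by linarith⟩ (by
    filter_upwards [Ioo_mem_nhds (show 1-ε < 1 by linarith) (show 1 < 1+ε by linarith)] with m hm
    have hm1 : -1 < m := by linarith [hm.1]
    have a1 := hε m hm1 hm.2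
    have a3 := hε3 m hm.1
    have hn : 0 < m + 1 := by linarith
    rw [e1 m hm.1, q1_eq, q2_out hm1 a1, h1 _ ⟨by linarith, by linarith⟩, h2 _ ⟨by linarith, by linarith⟩,
      Y1_even, Y2_even, y1_eq hn.ne' (by linarith), y2_pos' hn (by linarith)]
    ring)
  intro m h1 h2
  exact e2 m ⟨h1, h2⟩

lemma main_rel : y1 1 = (∑' n, tc (1/15) (4/15) (2/3) n) * y1 (-1) := by
  obtain ⟨α, β, γ, δ, h1, h2, hne⟩ := H1
  obtain ⟨a, b, c, ha, habc, g1, g2⟩ := H2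
  obtain ⟨M1, hM1, p⟩ := plem
  obtain ⟨M2, hM2, l⟩ := large_ev
  obtain ⟨ε, hε0, hε1, hε, hε3⟩ := geom
  have hM : 1 < max M1 M2 := lt_of_lt_of_le hM1 (le_max_left _ _)
  have L : ∀ m, max M1 M2 < m → α * y1 (-m) - β * y2 (-m) = a * q1 m + b * q2 m ∧
      γ * y1 (-m) - δ * y2 (-m) = c * q1 m + (-a) * q2 m := by
    intro m hm
    obtain ⟨p1, p2⟩ := p m (lt_of_le_of_lt (le_max_left _ _) hm)
    obtain ⟨⟨l1, l2⟩, l3, l4⟩ := l m (lt_of_le_of_lt (le_max_right _ _) hm)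
    have hn : -m + 1 < 0 := by linarith
    unfold Kf at p1 p2
    rw [h1 _ ⟨l3, l4⟩, g1 _ ⟨by linarith, l2⟩] at p1
    rw [h2 _ ⟨l3, l4⟩, g2 _ ⟨by linarith, l2⟩] at p2
    rw [y1_eq hn.ne (by linarith), y2_neg' hn (by linarith), q1_eq, q2_in (by linarith) (by linarith)]
    constructor
    · linear_combination p1
    · linear_combination p2
  have E1 := lin_ext hε0 hε1 hM hε hε3 h1 h2 (fun m hm => (L m hm).1)
  have E2 := lin_ext hε0 hε1 hM hε hε3 h1 h2 (fun m hm => (L m hm).2)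
  have y20 : y2 (-1) = 0 := by unfold y2; norm_num
  have i1 := E1 1 (by linarith) (by linarith)
  have i2 := E2 1 (by linarith) (by linarith)
  have j1 := E1 (-1) (by linarith) (by linarith)
  have j2 := E2 (-1) (by linarith) (by linarith)
  rw [neg_neg] at j1 j2
  rw [y20] at i1 i2 j1 j2
  rw [← ha]
  generalize y1 (-1) = y0 at *
  generalize y1 1 = F at *
  generalize y2 1 = Y at *
  have X : a * (α*F - a*α*y0) - b * (γ*F-a*γ*y0) = 0 := by
    linear_combination (-1/2) * i1 + (a/2) * j1 - (b/2) * j2 - (α*y0/2)*habc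
  have Z : c * (α*F - a*α*y0) + a * (γ*F-a*γ*y0) = 0 := by
    linear_combination (-1/2) * i2 + (c/2) * j1 + (a/2) * j2 - (γ*y0/2)*habc
  have X' : α * (F - a * y0) = 0 := by
    linear_combination a * X + b * Z - (α*F - a*α*y0) * habc
  have Z' : γ * (F - a * y0) = 0 := by
    linear_combination a * Z - c * X - (γ*F - a*γ*y0) * habc
  by_contra hc
  have hc' : F - a*y0 ≠ 0 := sub_ne_zero.2 hc
  exact hne ⟨(mul_eq_zero.1 X').resolve_right hc', (mul_eq_zero.1 Z').resolve_right hc'⟩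


lemma sin25 : Real.sin (2*Real.pi/5) = Real.sqrt 2 * Real.sqrt (5 + Real.sqrt 5) / 4 := by
  have h5 : Real.sqrt 5^2 = 5 := Real.sq_sqrt (by norm_num)
  have h0 : 0 ≤ Real.sqrt 5 := Real.sqrt_nonneg _
  have hp : 0 ≤ Real.sin (2*Real.pi/5) := by
    apply Real.sin_nonneg_of_nonneg_of_le_pi
    · positivity
    · linarith [Real.pi_pos]
  have hc : Real.cos (2*Real.pi/5) = (Real.sqrt 5 - 1)/4 := by
    rw [show 2*Real.pi/5 = 2*(Real.pi/5) by ring, Real.cos_two_mul, Real.cos_pi_div_five]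
    linear_combination (1/8)*h5
  have hs := Real.sin_sq_add_cos_sq (2*Real.pi/5)
  rw [hc] at hs
  rw [← sq_eq_sq₀ hp (by positivity), div_pow, mul_pow, Real.sq_sqrt (by norm_num), Real.sq_sqrt (by positivity)]
  linear_combination hs - (1/16)*h5

lemma final_rel : pw (-(1/15)) (190*Real.sqrt 5/9) * twoFone (1/30) (8/15) (9/10) (20736/45125) =
    (Real.sqrt 2 * Real.sqrt (5 + Real.sqrt 5) / 4 / (Real.sqrt 3/2)) * pw (-(1/15)) 162 := by
  have h5 : Real.sqrt 5^2 = 5 := Real.sq_sqrt (by norm_num)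
  have h := main_rel
  rw [gauss_val, sin25, Real.sin_pi_div_three] at h
  unfold y1 at h
  rw [NN_one, NN_neg_one, neg_neg, neg_neg] at h
  have e : ((1:ℝ)+1)^10/(-(190*Real.sqrt 5/9))^2 = 20736/45125 := by
    rw [neg_sq, div_pow, mul_pow, h5]; norm_num
  rw [e] at h
  rw [h]
  norm_num [F_zero]

theorem stmt9 : twoFone (1/30) (8/15) (9/10) (20736/45125) = (1/6) * Real.sqrt 2 * (3:ℝ) ^ ((1:ℝ)/10) * (5:ℝ) ^ ((1:ℝ)/10) * (19:ℝ) ^ ((1:ℝ)/15) * Real.sqrt (5 + Real.sqrt 5) := by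
  have h := final_rel
  have hp := pw_pos (-(1/15)) (190*Real.sqrt 5/9)
  have s5 : Real.sqrt 5 = pw (1/2) 5 := by rw [pw_rpow _ (by norm_num), Real.sqrt_eq_rpow]
  have s3 : Real.sqrt 3 = pw (1/2) 3 := by rw [pw_rpow _ (by norm_num), Real.sqrt_eq_rpow]
  apply mul_left_cancel₀ hp.ne'
  rw [h, ← pw_rpow _ (by norm_num), ← pw_rpow _ (by norm_num), ← pw_rpow _ (by norm_num)]
  have key : pw (-(1/15)) 162 = 1/3 * pw (1/2) 3 * pw (-(1/15)) (190*Real.sqrt 5/9) * pw (1/10) 3 * pw (1/10) 5 * pw (1/15) 19 := by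
    have l1 : Real.log (190*Real.sqrt 5/9) = Real.log 2 + Real.log 5 + Real.log 19 + (1/2)*Real.log 5 - 2*Real.log 3 := by
      rw [Real.log_div (by positivity) (by norm_num), Real.log_mul (by norm_num) (by positivity),
        Real.log_sqrt (by norm_num), show (190:ℝ) = 2*5*19 by norm_num, Real.log_mul (by norm_num) (by norm_num),
        Real.log_mul (by norm_num) (by norm_num), show (9:ℝ) = 3^2 by norm_num, Real.log_pow]
      push_cast
      ring
    have l2 : Real.log 162 = Real.log 2 + 4*Real.log 3 := by
      rw [show (162:ℝ) = 2*3^4 by norm_num, Real.log_mul (by norm_num) (by norm_num), Real.log_pow]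
      push_cast
      ring
    have e3 : (1/3:ℝ) = Real.exp (-Real.log 3) := by
      rw [Real.exp_neg, Real.exp_log (by norm_num)]; norm_num
    unfold pw
    rw [e3, ← Real.exp_add, ← Real.exp_add, ← Real.exp_add, ← Real.exp_add, ← Real.exp_add, l1, l2]
    congr 1
    ring
  rw [key, s3]
  have := pw_pos (1/2) 3
  field_simp
  ring
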